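/- arXiv:1801.10431 — 2 statements merged into one kernel-verified Lean document; each statement's English description precedes it below -/
import Mathlib

section
/- There exists a real constant c > 0 such that for every δ with 0 < δ ≤ 1 there exist a constant C > 0 and a positive integer n₀ with the following property: for every finite set A of real numbers with |A| ≥ n₀ such that at least δ·|A| elements of A are strictly positive, one has |AA+A| ≥ C·|A|^(3/2 + c). -/
/-- The number of elements of `X` below `x`. -/
noncomputable def rankIn (X : Finset ℝ) (x : ℝ) : ℕ := (X.filter (· < x)).card

lemma rankIn_mono (X : Finset ℝ) : Monotone (rankIn X) := by
  intro x y hxy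
  refine Finset.card_le_card fun z hz => ?_
  simp only [Finset.mem_filter] at hz ⊢
  exact ⟨hz.1, hz.2.trans_le hxy⟩

lemma rankIn_lt_rankIn {X : Finset ℝ} {x y : ℝ} (hx : x ∈ X) (hxy : x < y) :
    rankIn X x < rankIn X y := by
  refine Finset.card_lt_card (Finset.ssubset_iff_of_subset (fun z hz => ?_) |>.2 ⟨x, ?_, ?_⟩)
  · simp only [Finset.mem_filter] at hz ⊢
    exact ⟨hz.1, hz.2.trans hxy⟩
  · simp [hx, hxy]
  · simp

lemma rankIn_injOn (X : Finset ℝ) : Set.InjOn (rankIn X) X := by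
  intro x hx y hy h
  rcases lt_trichotomy x y with hxy | hxy | hxy
  · exact absurd h (rankIn_lt_rankIn hx hxy).ne
  · exact hxy
  · exact absurd h (rankIn_lt_rankIn hy hxy).ne'

lemma rankIn_le_card (X : Finset ℝ) (x : ℝ) : rankIn X x ≤ X.card :=
  Finset.card_le_card (Finset.filter_subset _ _)

lemma card_rankIn_div_eq_le (X : Finset ℝ) {q : ℕ} (hq : 0 < q) (c : ℕ) :
    (X.filter (fun x => c = rankIn X x / q)).card ≤ q := by
  have : (X.filter (fun x => c = rankIn X x / q)).card ≤ (Finset.Ico (c * q) (c * q + q)).card := by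
    refine Finset.card_le_card_of_injOn (rankIn X) (fun x hx => ?_)
      ((rankIn_injOn X).mono fun x hx => (Finset.mem_filter.1 hx).1)
    have h := (Finset.mem_filter.1 hx).2
    have h1 := Nat.div_add_mod (rankIn X x) q
    have h2 := Nat.mod_lt (rankIn X x) hq
    rw [← h] at h1
    simp only [Finset.coe_Ico, Set.mem_Ico]
    rw [mul_comm c q]
    omega
  simpa using this

lemma card_rankIn_pairs_le (X : Finset ℝ) {q : ℕ} (hq : 0 < q) :
    ((X ×ˢ X).filter (fun p => rankIn X p.1 / q = rankIn X p.2 / q)).card ≤ X.card * q := by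
  rw [Finset.card_filter, Finset.sum_product]
  refine (Finset.sum_le_card_nsmul _ _ q fun x _ => ?_).trans_eq (by simp)
  rw [← Finset.card_filter]
  exact card_rankIn_div_eq_le X hq (rankIn X x / q)

lemma card_le_add_card_offDiag {α : Type*} [DecidableEq α] (P : Finset α) (g : α → ℕ) (N : ℕ)
    (hg : ∀ x ∈ P, g x < N) :
    P.card ≤ N + (P.offDiag.filter (fun p => g p.1 = g p.2)).card := by
  have h1 : P.card = ∑ v ∈ Finset.range N, (P.filter (fun x => g x = v)).card :=
    Finset.card_eq_sum_card_fiberwise fun x hx => by simpa using hg x hx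
  have h2 : (P.offDiag.filter (fun p => g p.1 = g p.2)).card =
      ∑ v ∈ Finset.range N, (P.filter (fun x => g x = v)).offDiag.card := by
    rw [Finset.card_eq_sum_card_fiberwise (f := fun p => g p.1) (t := Finset.range N)]
    · refine Finset.sum_congr rfl fun v _ => congrArg _ ?_
      ext ⟨x, y⟩
      simp only [Finset.mem_filter, Finset.mem_offDiag]
      constructor
      · rintro ⟨⟨⟨hx, hy, hne⟩, he⟩, hv⟩
        exact ⟨⟨hx, hv⟩, ⟨hy, he ▸ hv⟩, hne⟩
      · rintro ⟨⟨hx, hv⟩, ⟨hy, hv'⟩, hne⟩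
        exact ⟨⟨⟨hx, hy, hne⟩, hv.trans hv'.symm⟩, hv⟩
    · intro p hp
      simp only [Finset.coe_filter, Finset.mem_offDiag, Set.mem_ofPred_eq] at hp
      simpa using hg _ hp.1.1
  have h3 : N = ∑ v ∈ Finset.range N, 1 := by simp
  rw [h1, h2]
  nth_rw 2 [h3]
  rw [← Finset.sum_add_distrib]
  refine Finset.sum_le_sum fun v _ => ?_
  rw [Finset.offDiag_card]
  rcases Nat.lt_or_ge (P.filter (fun x => g x = v)).card 2 with h | h
  · omega
  · have : 2 * (P.filter (fun x => g x = v)).card ≤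
      (P.filter (fun x => g x = v)).card * (P.filter (fun x => g x = v)).card :=
        Nat.mul_le_mul_right _ h
    omega

/-- The abscissae of the points of `X × Y` on the line `y = ℓ.1 * x + ℓ.2`. -/
noncomputable def onLine (X Y : Finset ℝ) (l : ℝ × ℝ) : Finset ℝ :=
  X.filter (fun x => l.1 * x + l.2 ∈ Y)

/-- The pairs of distinct points on a line lying in the same cell of the grid obtained by cutting
`X` and `Y` into intervals with `q` elements. -/
noncomputable def cellPairs (X Y : Finset ℝ) (q : ℕ) (l : ℝ × ℝ) : Finset (ℝ × ℝ) :=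
  (onLine X Y l).offDiag.filter (fun p => rankIn X p.1 / q = rankIn X p.2 / q ∧
    rankIn Y (l.1 * p.1 + l.2) / q = rankIn Y (l.1 * p.2 + l.2) / q)

lemma card_onLine_le (X Y : Finset ℝ) {m q : ℕ} (hX : X.card ≤ m) (hY : Y.card ≤ m)
    (l : ℝ × ℝ) (hl : l.1 ≠ 0) :
    (onLine X Y l).card ≤ 2 * (m / q) + 1 + (cellPairs X Y q l).card := by
  have hcx : ∀ x, rankIn X x / q ≤ m / q := fun x =>
    Nat.div_le_div_right ((rankIn_le_card X x).trans hX)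
  have hcy : ∀ y, rankIn Y y / q ≤ m / q := fun y =>
    Nat.div_le_div_right ((rankIn_le_card Y y).trans hY)
  have mx : ∀ x x', x ≤ x' → rankIn X x / q ≤ rankIn X x' / q := fun x x' h =>
    Nat.div_le_div_right (rankIn_mono X h)
  have my : ∀ x x', x ≤ x' → rankIn Y x / q ≤ rankIn Y x' / q := fun x x' h =>
    Nat.div_le_div_right (rankIn_mono Y h)
  rcases lt_or_gt_of_ne hl with hneg | hpos
  · refine (card_le_add_card_offDiag (onLine X Y l)
      (fun x => rankIn X x / q + (m / q - rankIn Y (l.1 * x + l.2) / q)) (2 * (m / q) + 1)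
      fun x _ => ?_).trans ?_
    · have h1 := hcx x
      have h2 := Nat.sub_le (m / q) (rankIn Y (l.1 * x + l.2) / q)
      linarith
    · refine Nat.add_le_add_left (Finset.card_le_card fun p hp => ?_) _
      simp only [cellPairs, Finset.mem_filter] at hp ⊢
      refine ⟨hp.1, ?_⟩
      have h := hp.2
      have a1 := hcy (l.1 * p.1 + l.2)
      have a2 := hcy (l.1 * p.2 + l.2)
      rcases le_total p.1 p.2 with h1 | h1
      · have b1 := mx _ _ h1
        have b2 := my (l.1 * p.2 + l.2) (l.1 * p.1 + l.2) (by nlinarith)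
        omega
      · have b1 := mx _ _ h1
        have b2 := my (l.1 * p.1 + l.2) (l.1 * p.2 + l.2) (by nlinarith)
        omega
  · refine (card_le_add_card_offDiag (onLine X Y l)
      (fun x => rankIn X x / q + rankIn Y (l.1 * x + l.2) / q) (2 * (m / q) + 1)
      fun x _ => ?_).trans ?_
    · have := hcx x
      have := hcy (l.1 * x + l.2)
      omega
    · refine Nat.add_le_add_left (Finset.card_le_card fun p hp => ?_) _
      simp only [cellPairs, Finset.mem_filter] at hp ⊢
      refine ⟨hp.1, ?_⟩
      have h := hp.2
      rcases le_total p.1 p.2 with h1 | h1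
      · have b1 := mx _ _ h1
        have b2 := my (l.1 * p.1 + l.2) (l.1 * p.2 + l.2) (by nlinarith)
        omega
      · have b1 := mx _ _ h1
        have b2 := my (l.1 * p.2 + l.2) (l.1 * p.1 + l.2) (by nlinarith)
        omega

lemma sum_card_cellPairs_le (X Y : Finset ℝ) {q : ℕ} (hq : 0 < q) (L : Finset (ℝ × ℝ)) :
    ∑ l ∈ L, (cellPairs X Y q l).card ≤ (X.card * q) * (Y.card * q) := by
  rw [← Finset.card_sigma]
  refine le_trans ?_ (Nat.mul_le_mul (card_rankIn_pairs_le X hq) (card_rankIn_pairs_le Y hq))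
  rw [← Finset.card_product]
  refine Finset.card_le_card_of_injOn
    (fun z => (z.2, (z.1.1 * z.2.1 + z.1.2, z.1.1 * z.2.2 + z.1.2))) ?_ ?_
  · rintro ⟨l, x, x'⟩ h
    simp only [cellPairs, onLine, Finset.coe_sigma, Set.mem_sigma_iff, Finset.mem_coe,
      Finset.mem_filter, Finset.mem_offDiag, Finset.mem_product] at h ⊢
    tauto
  · rintro ⟨⟨s, b⟩, x, x'⟩ h ⟨⟨s', b'⟩, z, z'⟩ h' he
    simp only [cellPairs, onLine, Finset.coe_sigma, Set.mem_sigma_iff, Finset.mem_coe,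
      Finset.mem_filter, Finset.mem_offDiag] at h h'
    simp only [Prod.mk.injEq] at he
    obtain ⟨⟨rfl, rfl⟩, h1, h2⟩ := he
    have hne : x - x' ≠ 0 := sub_ne_zero.2 h.2.1.2.2
    have : s = s' := by
      apply mul_right_cancel₀ hne
      linarith
    subst this
    have : b = b' := by linarith
    subst this
    rfl

/-- An incidence bound for Cartesian products. -/
theorem sum_card_onLine_le (X Y : Finset ℝ) {m q : ℕ} (hX : X.card ≤ m) (hY : Y.card ≤ m)
    (hq : 0 < q) (L : Finset (ℝ × ℝ)) (hL : ∀ l ∈ L, l.1 ≠ 0) :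
    ∑ l ∈ L, (onLine X Y l).card ≤ L.card * (2 * (m / q) + 1) + m ^ 2 * q ^ 2 := by
  calc ∑ l ∈ L, (onLine X Y l).card
      ≤ ∑ l ∈ L, (2 * (m / q) + 1 + (cellPairs X Y q l).card) :=
        Finset.sum_le_sum fun l hl => card_onLine_le X Y hX hY l (hL l hl)
    _ = L.card * (2 * (m / q) + 1) + ∑ l ∈ L, (cellPairs X Y q l).card := by
        rw [Finset.sum_add_distrib]; simp
    _ ≤ L.card * (2 * (m / q) + 1) + (X.card * q) * (Y.card * q) :=
        Nat.add_le_add_left (sum_card_cellPairs_le X Y hq L) _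
    _ ≤ L.card * (2 * (m / q) + 1) + (m * q) * (m * q) := by gcongr
    _ = _ := by ring

/-- The number of `k`-rich lines in a Cartesian product. -/
theorem card_rich_lines_le (X Y : Finset ℝ) {m : ℕ} (hX : X.card ≤ m) (hY : Y.card ≤ m)
    (L : Finset (ℝ × ℝ)) (hL : ∀ l ∈ L, l.1 ≠ 0) {k : ℕ} (hk : 4 ≤ k)
    (hr : ∀ l ∈ L, k ≤ (onLine X Y l).card) :
    (L.card : ℝ) * (k : ℝ) ^ 3 ≤ 162 * (m : ℝ) ^ 4 := by
  rcases L.eq_empty_or_nonempty with rfl | ⟨l₀, hl₀⟩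
  · simp
  have hkm : k ≤ m := (hr l₀ hl₀).trans ((Finset.card_le_card (Finset.filter_subset _ _)).trans hX)
  have hk' : (4 : ℝ) ≤ k := by exact_mod_cast hk
  have hkm' : (k : ℝ) ≤ m := by exact_mod_cast hkm
  set q : ℕ := ⌈8 * (m : ℝ) / k⌉₊ with hqdef
  have hq1 : 8 * (m : ℝ) / k ≤ q := Nat.le_ceil _
  have hq2 : (q : ℝ) < 8 * (m : ℝ) / k + 1 := Nat.ceil_lt_add_one (by positivity)
  have hq0 : 0 < (q : ℝ) := lt_of_lt_of_le (div_pos (by linarith) (by linarith)) hq1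
  have hI := sum_card_onLine_le X Y hX hY (by exact_mod_cast hq0 : 0 < q) L hL
  have hI2 : L.card * k ≤ ∑ l ∈ L, (onLine X Y l).card := by
    simpa using Finset.card_nsmul_le_sum L _ k hr
  have hI3 : (L.card : ℝ) * k ≤ L.card * (2 * (m / q : ℕ) + 1) + m ^ 2 * q ^ 2 := by
    exact_mod_cast hI2.trans hI
  have hdiv : ((m / q : ℕ) : ℝ) ≤ k / 8 := by
    refine Nat.cast_div_le.trans ?_
    rw [div_le_iff₀ hq0]
    rw [div_le_iff₀ (by positivity)] at hq1
    linarith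
  have hqk : (q : ℝ) * k ≤ 9 * m := by
    have : (q : ℝ) * k ≤ (8 * (m : ℝ) / k + 1) * k := by gcongr
    have e : (8 * (m : ℝ) / k + 1) * k = 8 * m + k := by field_simp
    linarith
  have h4 : (L.card : ℝ) * k ≤ 2 * (m ^ 2 * q ^ 2) := by
    have : (L.card : ℝ) * (2 * (m / q : ℕ) + 1) ≤ L.card * (k / 2) := by
      gcongr
      linarith
    linarith
  have h5 : ((q : ℝ) * k) ^ 2 ≤ (9 * m) ^ 2 := by gcongr
  have h6 : (m : ℝ) ^ 2 * ((q : ℝ) * k) ^ 2 ≤ m ^ 2 * (9 * m) ^ 2 := by gcongr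
  have h7 : (L.card : ℝ) * k * (k : ℝ) ^ 2 ≤ 2 * (m ^ 2 * q ^ 2) * (k : ℝ) ^ 2 := by gcongr
  nlinarith only [h6, h7]

/-- The set `AA + A`. -/
noncomputable def mulAddSet (A : Finset ℝ) : Finset ℝ :=
  (A ×ˢ A ×ˢ A).image (fun p : ℝ × ℝ × ℝ => p.1 * p.2.1 + p.2.2)

lemma mem_mulAddSet {A : Finset ℝ} {a b c : ℝ} (ha : a ∈ A) (hb : b ∈ A) (hc : c ∈ A) :
    a * b + c ∈ mulAddSet A :=
  Finset.mem_image.2 ⟨(a, b, c), by simp [ha, hb, hc], rfl⟩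

/-- The slopes of the lines through the origin meeting `A × A`. -/
noncomputable def slopeSet (A : Finset ℝ) : Finset ℝ :=
  (A ×ˢ A).image (fun p : ℝ × ℝ => p.2 / p.1)

/-- The abscissae of the points of `A × A` on the line of slope `t` through the origin. -/
noncomputable def slopeFiber (A : Finset ℝ) (t : ℝ) : Finset ℝ :=
  A.filter (fun x => t * x ∈ A)

lemma slopeSet_pos {A : Finset ℝ} (hA : ∀ a ∈ A, 0 < a) {t : ℝ} (ht : t ∈ slopeSet A) : 0 < t := by
  obtain ⟨⟨b, c⟩, h, rfl⟩ := Finset.mem_image.1 ht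
  rw [Finset.mem_product] at h
  exact div_pos (hA _ h.2) (hA _ h.1)

lemma slopeFiber_nonempty {A : Finset ℝ} (hA : ∀ a ∈ A, 0 < a) {t : ℝ} (ht : t ∈ slopeSet A) :
    (slopeFiber A t).Nonempty := by
  obtain ⟨⟨b, c⟩, h, rfl⟩ := Finset.mem_image.1 ht
  rw [Finset.mem_product] at h
  refine ⟨b, Finset.mem_filter.2 ⟨h.1, ?_⟩⟩
  have := (hA _ h.1).ne'
  simpa [div_mul_cancel₀ _ this] using h.2

lemma sum_card_slopeFiber {A : Finset ℝ} (hA : ∀ a ∈ A, 0 < a) :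
    ∑ t ∈ slopeSet A, (slopeFiber A t).card = A.card ^ 2 := by
  rw [sq, ← Finset.card_product, ← Finset.card_sigma]
  refine Finset.card_nbij' (fun z => (z.2, z.1 * z.2)) (fun p => ⟨p.2 / p.1, p.1⟩) ?_ ?_ ?_ ?_
  · rintro ⟨t, x⟩ h
    simp only [Finset.coe_sigma, Set.mem_sigma_iff, Finset.mem_coe, slopeFiber,
      Finset.mem_filter] at h
    simpa using h.2
  · rintro ⟨x, y⟩ h
    simp only [Finset.coe_product, Set.mem_prod, Finset.mem_coe] at h
    have := (hA _ h.1).ne'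
    simp only [Finset.coe_sigma, Set.mem_sigma_iff, Finset.mem_coe, slopeFiber,
      Finset.mem_filter, slopeSet, Finset.mem_image]
    exact ⟨⟨(x, y), by simp [h], rfl⟩, h.1, by simpa [div_mul_cancel₀ _ this] using h.2⟩
  · rintro ⟨t, x⟩ h
    simp only [Finset.coe_sigma, Set.mem_sigma_iff, Finset.mem_coe, slopeFiber,
      Finset.mem_filter] at h
    have := (hA _ h.2.1).ne'
    simp [this]
  · rintro ⟨x, y⟩ h
    simp only [Finset.coe_product, Set.mem_prod, Finset.mem_coe] at h
    have := (hA _ h.1).ne'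
    simp [div_mul_cancel₀ _ this]

/-- The lines through points of `A × A` with slope in `slopeSet A`. -/
noncomputable def slopeLines (A : Finset ℝ) : Finset (ℝ × ℝ) :=
  (slopeSet A ×ˢ A ×ˢ A).image (fun z => (z.1, z.2.2 - z.1 * z.2.1))

lemma slopeLines_slope_ne_zero {A : Finset ℝ} (hA : ∀ a ∈ A, 0 < a) :
    ∀ l ∈ slopeLines A, l.1 ≠ 0 := by
  intro l hl
  obtain ⟨⟨t, u, v⟩, h, rfl⟩ := Finset.mem_image.1 hl
  exact (slopeSet_pos hA (Finset.mem_product.1 h).1).ne'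

lemma card_le_onLine_mulAddSet {A : Finset ℝ} (hA : ∀ a ∈ A, 0 < a) :
    ∀ l ∈ slopeLines A, A.card ≤ (onLine (mulAddSet A) (mulAddSet A) l).card := by
  intro l hl
  obtain ⟨⟨t, u, v⟩, h, rfl⟩ := Finset.mem_image.1 hl
  simp only [Finset.mem_product] at h
  obtain ⟨ht, hu, hv⟩ := h
  obtain ⟨⟨b, c⟩, h, rfl⟩ := Finset.mem_image.1 ht
  rw [Finset.mem_product] at h
  have hb := (hA _ h.1).ne'
  dsimp only at h hb ⊢
  refine Finset.card_le_card_of_injOn (fun a => a * b + u) (fun a ha => ?_) ?_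
  · refine Finset.mem_coe.2 (Finset.mem_filter.2 ⟨mem_mulAddSet ha h.1 hu, ?_⟩)
    have : c / b * (a * b + u) + (v - c / b * u) = a * c + v := by
      field_simp
      ring
    dsimp only
    rw [this]
    exact mem_mulAddSet ha h.2 hv
  · intro a _ a' _ he
    have : a * b = a' * b := by simpa using he
    exact mul_right_cancel₀ hb this

lemma card_slopeSet_mul_le (A : Finset ℝ) :
    (slopeSet A).card * A.card ^ 2 ≤ ∑ l ∈ slopeLines A, (onLine A A l).card := by
  rw [← Finset.card_sigma, sq, ← Finset.card_product, ← Finset.card_product]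
  refine Finset.card_le_card_of_injOn
    (fun z => ⟨(z.1, z.2.2 - z.1 * z.2.1), z.2.1⟩) ?_ ?_
  · rintro ⟨t, u, v⟩ h
    have h' := h
    simp only [Finset.coe_product, Set.mem_prod, Finset.mem_coe] at h
    simp only [Finset.coe_sigma, Set.mem_sigma_iff, Finset.mem_coe]
    refine ⟨Finset.mem_image.2 ⟨(t, u, v), h', rfl⟩, Finset.mem_filter.2 ⟨h.2.1, ?_⟩⟩
    simpa using h.2.2
  · rintro ⟨t, u, v⟩ _ ⟨t', u', v'⟩ _ he
    simp only [Sigma.mk.injEq, Prod.mk.injEq, heq_eq_eq] at he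
    obtain ⟨⟨rfl, h⟩, rfl⟩ := he
    simpa using h

/-- If `AA + A` is small, then `A × A` is covered by few lines through the origin. -/
theorem card_slopeSet_le {A : Finset ℝ} (hA : ∀ a ∈ A, 0 < a) {K s : ℝ} (hK : 1 ≤ K) (hs : 4 ≤ s)
    (hn : s ^ 9 = A.card) (hS : ((mulAddSet A).card : ℝ) ^ 2 ≤ K * (A.card : ℝ) ^ 3) :
    ((slopeSet A).card : ℝ) ≤ 490 * K ^ 2 * s ^ 12 := by
  have hs0 : 0 < s := by linarith
  have hs1 : 1 ≤ s := by linarith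
  have hn4 : (4 : ℝ) ≤ A.card := by
    rw [← hn]
    exact hs.trans (le_self_pow₀ hs1 (by norm_num))
  have hn4' : 4 ≤ A.card := by exact_mod_cast hn4
  have hR := card_rich_lines_le (mulAddSet A) (mulAddSet A) le_rfl le_rfl (slopeLines A)
    (slopeLines_slope_ne_zero hA) hn4' (card_le_onLine_mulAddSet hA)
  set q : ℕ := ⌈s ^ 6⌉₊ with hq
  have hq1 : s ^ 6 ≤ q := Nat.le_ceil _
  have hq0 : (0 : ℝ) < q := lt_of_lt_of_le (by positivity) hq1
  have hq2 : (q : ℝ) ≤ 2 * s ^ 6 := by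
    have h1 : (q : ℝ) < s ^ 6 + 1 := Nat.ceil_lt_add_one (by positivity)
    have h2 : 1 ≤ s ^ 6 := one_le_pow₀ hs1
    linarith
  have hI := (card_slopeSet_mul_le A).trans (sum_card_onLine_le A A le_rfl le_rfl
    (by exact_mod_cast hq0 : 0 < q) (slopeLines A) (slopeLines_slope_ne_zero hA))
  have hI' : ((slopeSet A).card : ℝ) * (A.card : ℝ) ^ 2 ≤
      (slopeLines A).card * (2 * ((A.card / q : ℕ) : ℝ) + 1) + (A.card : ℝ) ^ 2 * (q : ℝ) ^ 2 := by
    exact_mod_cast hI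
  have hdiv : ((A.card / q : ℕ) : ℝ) ≤ s ^ 3 := by
    refine Nat.cast_div_le.trans ?_
    rw [div_le_iff₀ hq0, ← hn]
    calc s ^ 9 = s ^ 3 * s ^ 6 := by ring
      _ ≤ s ^ 3 * q := by gcongr
  rw [← hn] at hR hS hI'
  generalize ((slopeLines A).card : ℝ) = L at *
  generalize ((slopeSet A).card : ℝ) = d at *
  generalize ((mulAddSet A).card : ℝ) = S at *
  have hL : L ≤ 162 * K ^ 2 * s ^ 27 := by
    have h1 : S ^ 4 ≤ (K * (s ^ 9) ^ 3) ^ 2 := by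
      calc S ^ 4 = (S ^ 2) ^ 2 := by ring
        _ ≤ _ := by gcongr
    have h2 : L * (s ^ 9) ^ 3 ≤ (162 * K ^ 2 * s ^ 27) * (s ^ 9) ^ 3 := by
      calc L * (s ^ 9) ^ 3 ≤ 162 * S ^ 4 := hR
        _ ≤ 162 * (K * (s ^ 9) ^ 3) ^ 2 := by gcongr
        _ = _ := by ring
    exact le_of_mul_le_mul_right h2 (by positivity)
  have h3 : (1 : ℝ) ≤ s ^ 3 := one_le_pow₀ hs1
  have hK2 : 1 ≤ K ^ 2 := one_le_pow₀ hK
  have h4 : d * (s ^ 9) ^ 2 ≤ (490 * K ^ 2 * s ^ 12) * (s ^ 9) ^ 2 := by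
    calc d * (s ^ 9) ^ 2 ≤ L * (2 * ((A.card / q : ℕ) : ℝ) + 1) + (s ^ 9) ^ 2 * (q : ℝ) ^ 2 := hI'
      _ ≤ (162 * K ^ 2 * s ^ 27) * (2 * s ^ 3 + s ^ 3) + (s ^ 9) ^ 2 * (2 * s ^ 6) ^ 2 := by
          gcongr
      _ = 486 * K ^ 2 * s ^ 30 + 4 * 1 * s ^ 30 := by ring
      _ ≤ 486 * K ^ 2 * s ^ 30 + 4 * K ^ 2 * s ^ 30 := by gcongr
      _ = _ := by ring
  exact le_of_mul_le_mul_right h4 (by positivity)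

/-- The number of points of `A × A` on a line in general position, when `A` has a small product
set with one of its subsets. -/
theorem card_solutions_le {A H : Finset ℝ} (hH : ∀ a ∈ H, 0 < a) {m : ℕ}
    (hm : ((A ×ˢ H).image (fun p => p.1 * p.2)).card ≤ m)
    {α β γ : ℝ} (hα : α ≠ 0) (hβ : β ≠ 0) (hγ : γ ≠ 0)
    (hR : 4 ≤ ((A ×ˢ A).filter (fun p => α * p.1 + β * p.2 = γ)).card) :
    (H.card : ℝ) ^ 2 * (((A ×ˢ A).filter (fun p => α * p.1 + β * p.2 = γ)).card : ℝ) ^ 3 ≤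
      162 * (m : ℝ) ^ 4 := by
  set W := (A ×ˢ H).image (fun p => p.1 * p.2) with hW
  set L : Finset (ℝ × ℝ) :=
    (H ×ˢ H).image (fun p => (-(α * p.2) / (β * p.1), p.2 * γ / β)) with hL
  have hcard : L.card = H.card ^ 2 := by
    rw [hL, Finset.card_image_of_injOn, Finset.card_product, sq]
    rintro ⟨w, v⟩ h ⟨w', v'⟩ h' he
    simp only [Finset.coe_product, Set.mem_prod, Finset.mem_coe] at h h'
    simp only [Prod.mk.injEq] at he
    have hw := (hH _ h.1).ne'
    have hv := (hH _ h.2).ne'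
    have hw' := (hH _ h'.1).ne'
    have e2 : v = v' := by
      have := he.2
      field_simp at this
      exact this
    subst e2
    have e1 : w = w' := by
      have := he.1
      field_simp at this
      linarith
    rw [e1]
  have := card_rich_lines_le W W hm hm L (fun l hl => ?_) hR (fun l hl => ?_)
  · rw [hcard] at this
    exact_mod_cast this
  · obtain ⟨⟨w, v⟩, h, rfl⟩ := Finset.mem_image.1 hl
    rw [Finset.mem_product] at h
    have hw := (hH _ h.1).ne'
    have hv := (hH _ h.2).ne'
    dsimp only at hw hv ⊢
    exact div_ne_zero (neg_ne_zero.2 (mul_ne_zero hα hv)) (mul_ne_zero hβ hw)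
  · obtain ⟨⟨w, v⟩, h, rfl⟩ := Finset.mem_image.1 hl
    rw [Finset.mem_product] at h
    have hw := (hH _ h.1).ne'
    dsimp only at h hw ⊢
    refine Finset.card_le_card_of_injOn (fun p => p.1 * w) ?_ ?_
    · rintro ⟨a, b⟩ hab
      simp only [Finset.coe_filter, Finset.mem_product, Set.mem_ofPred_eq] at hab
      refine Finset.mem_coe.2 (Finset.mem_filter.2
        ⟨Finset.mem_image.2 ⟨(a, w), by simp [hab, h], rfl⟩, ?_⟩)
      have e : -(α * v) / (β * w) * (a * w) + v * γ / β = b * v := by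
        rw [← hab.2]
        field_simp
        ring
      dsimp only
      rw [e]
      exact Finset.mem_image.2 ⟨(b, v), by simp [hab, h], rfl⟩
    · rintro ⟨a, b⟩ hab ⟨a', b'⟩ hab' he
      simp only [Finset.coe_filter, Finset.mem_product, Set.mem_ofPred_eq] at hab hab'
      have e1 : a = a' := mul_right_cancel₀ hw he
      subst e1
      have e2 : b = b' := by
        apply mul_left_cancel₀ hβ
        linarith
      rw [e2]

lemma exists_initial_segment (D : Finset ℝ) (k : ℕ) (hk : k ≤ D.card) :
    ∃ B ⊆ D, B.card = k ∧ ∀ x ∈ B, ∀ y ∈ D \ B, x < y := by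
  induction k with
  | zero => exact ⟨∅, by simp, by simp, by simp⟩
  | succ k ih =>
    obtain ⟨B, hBD, hB, hlt⟩ := ih (by omega)
    have hne : (D \ B).Nonempty := by
      rw [← Finset.card_pos, Finset.card_sdiff_of_subset hBD]
      omega
    have hmem := Finset.min'_mem _ hne
    set z := (D \ B).min' hne with hz
    rw [Finset.mem_sdiff] at hmem
    refine ⟨insert z B, Finset.insert_subset hmem.1 hBD, ?_, ?_⟩
    · rw [Finset.card_insert_of_notMem hmem.2, hB]
    · intro x hx y hy
      simp only [Finset.mem_sdiff, Finset.mem_insert, not_or] at hy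
      have hy' : y ∈ D \ B := Finset.mem_sdiff.2 ⟨hy.1, hy.2.2⟩
      rcases Finset.mem_insert.1 hx with rfl | hx
      · exact lt_of_le_of_ne (Finset.min'_le _ _ hy') (Ne.symm hy.2.1)
      · exact hlt x hx y hy'

/-- The points of `U` lie strictly inside the cone spanned by lines with slopes in `B`. -/
def InCone (U : Finset (ℝ × ℝ)) (B : Finset ℝ) : Prop :=
  ∀ p ∈ U, 0 < p.1 ∧ (∃ l ∈ B, l * p.1 < p.2) ∧ ∃ u ∈ B, p.2 < u * p.1

lemma InCone.disjoint {U V : Finset (ℝ × ℝ)} {B D : Finset ℝ} (hU : InCone U B) (hV : InCone V D)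
    (h : ∀ x ∈ B, ∀ y ∈ D, x < y) : Disjoint U V := by
  rw [Finset.disjoint_left]
  intro p hp hp'
  obtain ⟨h0, -, u, hu, hup⟩ := hU p hp
  obtain ⟨-, ⟨l, hl, hlp⟩, -⟩ := hV p hp'
  have := h u hu l hl
  nlinarith

/-- If every block of `M` slopes yields many points of `T` inside its cone, then `T` is large. -/
theorem mul_sum_sub_le_card_of_blocks (w : ℝ → ℝ) {n κ : ℝ} (hκ : 0 ≤ κ)
    {M : ℕ} (hM : 0 < M) (D : Finset ℝ) (hwn : ∀ t ∈ D, w t ≤ n) (hn : 0 ≤ n) :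
    ∀ T : Finset (ℝ × ℝ),
    (∀ B ⊆ D, B.card = M → ∃ U ⊆ T, InCone U B ∧ κ * ∑ t ∈ B, w t ≤ U.card) →
    ∃ V ⊆ T, InCone V D ∧ κ * (∑ t ∈ D, w t - M * n) ≤ V.card := by
  induction D using Finset.strongInduction with
  | H D ih =>
    intro T h
    rcases Nat.lt_or_ge D.card M with hc | hc
    · refine ⟨∅, by simp, by simp [InCone], ?_⟩
      have h1 : ∑ t ∈ D, w t ≤ D.card * n := by
        simpa using Finset.sum_le_card_nsmul D w n hwn
      have h2 : (D.card : ℝ) ≤ M := by exact_mod_cast hc.le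
      have h3 : ∑ t ∈ D, w t - M * n ≤ 0 := by nlinarith
      simpa using mul_nonpos_of_nonneg_of_nonpos hκ h3
    · obtain ⟨B, hBD, hB, hlt⟩ := exists_initial_segment D M hc
      have hBne : B.Nonempty := by rw [← Finset.card_pos]; omega
      obtain ⟨U, hUT, hU, hUc⟩ := h B hBD hB
      obtain ⟨V, hVT, hV, hVc⟩ := ih (D \ B) (Finset.sdiff_ssubset hBD hBne)
        (fun t ht => hwn t (Finset.sdiff_subset ht)) T
        (fun B' hB' => h B' (hB'.trans Finset.sdiff_subset))
      refine ⟨U ∪ V, Finset.union_subset hUT hVT, ?_, ?_⟩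
      · intro p hp
        rcases Finset.mem_union.1 hp with hp | hp
        · obtain ⟨h0, ⟨l, hl, hl'⟩, u, hu, hu'⟩ := hU p hp
          exact ⟨h0, ⟨l, hBD hl, hl'⟩, u, hBD hu, hu'⟩
        · obtain ⟨h0, ⟨l, hl, hl'⟩, u, hu, hu'⟩ := hV p hp
          exact ⟨h0, ⟨l, Finset.sdiff_subset hl, hl'⟩, u, Finset.sdiff_subset hu, hu'⟩
      · rw [Finset.card_union_of_disjoint (hU.disjoint hV hlt),
          ← Finset.sum_sdiff hBD]
        push_cast
        linarith

lemma sum_card_sub_le_card_biUnion {ι β : Type*} [DecidableEq ι] [DecidableEq β]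
    (E : Finset ι) (U : ι → Finset β) (r : ι → ℝ) (hr0 : ∀ e ∈ E, 0 ≤ r e)
    (hr : ∀ e ∈ E, ∀ f ∈ E, e ≠ f → ((U e ∩ U f).card : ℝ) ≤ r e) :
    ∑ e ∈ E, ((U e).card - E.card * r e) ≤ ((E.biUnion U).card : ℝ) := by
  set V : ι → Finset β := fun e => U e \ (E.erase e).biUnion U with hV
  have hdisj : (E : Set ι).PairwiseDisjoint V := by
    intro e he f hf hef
    rw [Function.onFun, Finset.disjoint_left]
    intro x hx hx'
    simp only [hV, Finset.mem_sdiff, Finset.mem_biUnion, Finset.mem_erase, not_exists,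
      not_and] at hx hx'
    exact hx.2 f ⟨hef.symm, hf⟩ hx'.1
  have hsub : E.biUnion V ⊆ E.biUnion U :=
    Finset.biUnion_mono fun e _ => Finset.sdiff_subset
  have h1 : ∑ e ∈ E, ((V e).card : ℝ) ≤ (E.biUnion U).card := by
    have := Finset.card_le_card hsub
    rw [Finset.card_biUnion hdisj] at this
    exact_mod_cast this
  refine le_trans (Finset.sum_le_sum fun e he => ?_) h1
  have h2 : U e ⊆ V e ∪ (E.erase e).biUnion (fun f => U e ∩ U f) := by
    intro x hx
    by_cases h : x ∈ (E.erase e).biUnion U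
    · obtain ⟨f, hf, hxf⟩ := Finset.mem_biUnion.1 h
      exact Finset.mem_union_right _
        (Finset.mem_biUnion.2 ⟨f, hf, Finset.mem_inter.2 ⟨hx, hxf⟩⟩)
    · exact Finset.mem_union_left _ (Finset.mem_sdiff.2 ⟨hx, h⟩)
  have h3 : ((U e).card : ℝ) ≤ (V e).card + ∑ f ∈ E.erase e, ((U e ∩ U f).card : ℝ) := by
    have := (Finset.card_le_card h2).trans ((Finset.card_union_le _ _).trans
      (Nat.add_le_add_left Finset.card_biUnion_le _))
    exact_mod_cast this
  have h4 : ∑ f ∈ E.erase e, ((U e ∩ U f).card : ℝ) ≤ (E.erase e).card * r e := by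
    simpa using Finset.sum_le_card_nsmul (E.erase e) (fun f => ((U e ∩ U f).card : ℝ)) (r e)
      fun f hf => hr e he f (Finset.mem_of_mem_erase hf) (Finset.ne_of_mem_erase hf).symm
  have h5 : ((E.erase e).card : ℝ) * r e ≤ E.card * r e := by
    gcongr
    · exact hr0 e he
    · exact Finset.erase_subset _ _
  linarith

/-- Sums of the points with abscissa in `P` on the line of slope `i` and the points with abscissa
in `Q` on the line of slope `j`. -/
noncomputable def coneSum (P Q : Finset ℝ) (i j : ℝ) : Finset (ℝ × ℝ) :=
  (P ×ˢ Q).image (fun p => (p.1 + p.2, i * p.1 + j * p.2))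

lemma card_coneSum (P Q : Finset ℝ) {i j : ℝ} (hij : i ≠ j) :
    (coneSum P Q i j).card = P.card * Q.card := by
  rw [coneSum, Finset.card_image_of_injective, Finset.card_product]
  rintro ⟨a, x⟩ ⟨b, y⟩ h
  simp only [Prod.mk.injEq] at h
  have e : a = b := by
    apply mul_right_cancel₀ (sub_ne_zero.2 hij)
    linear_combination h.2 - j * h.1
  subst e
  simpa using h.1

lemma inCone_coneSum {P Q : Finset ℝ} (hP : ∀ a ∈ P, 0 < a) (hQ : ∀ a ∈ Q, 0 < a) {i j : ℝ}
    (hij : i ≠ j) {B : Finset ℝ} (hi : i ∈ B) (hj : j ∈ B) : InCone (coneSum P Q i j) B := by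
  intro p hp
  obtain ⟨⟨a, x⟩, h, rfl⟩ := Finset.mem_image.1 hp
  rw [Finset.mem_product] at h
  have ha := hP _ h.1
  have hx := hQ _ h.2
  dsimp only at ha hx ⊢
  refine ⟨add_pos ha hx, ?_⟩
  rcases lt_or_gt_of_ne hij with h | h
  · exact ⟨⟨i, hi, by nlinarith⟩, j, hj, by nlinarith⟩
  · exact ⟨⟨j, hj, by nlinarith⟩, i, hi, by nlinarith⟩

lemma coneSum_subset {A P : Finset ℝ} {i j : ℝ}
    (hP : P ⊆ (A ×ˢ slopeFiber A i).image (fun p => p.1 * p.2)) :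
    coneSum P (slopeFiber A j) i j ⊆ mulAddSet A ×ˢ mulAddSet A := by
  intro p hp
  obtain ⟨⟨u, x⟩, h, rfl⟩ := Finset.mem_image.1 hp
  rw [Finset.mem_product] at h
  obtain ⟨⟨a, b⟩, hab, h1⟩ := Finset.mem_image.1 (hP h.1)
  have hx := Finset.mem_filter.1 h.2
  rw [Finset.mem_product] at hab
  have hb := Finset.mem_filter.1 hab.2
  dsimp only at h1 hx hb hab ⊢
  subst h1
  refine Finset.mem_product.2 ⟨mem_mulAddSet hab.1 hb.1 hx.1, ?_⟩
  have : i * (a * b) + j * x = a * (i * b) + j * x := by ring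
  dsimp only
  rw [this]
  exact mem_mulAddSet hab.1 hb.2 hx.2

/-- The number of points of `A × A` on any line in general position is at most `R`. -/
def FewOnLines (A : Finset ℝ) (R : ℝ) : Prop :=
  ∀ α β γ : ℝ, α ≠ 0 → β ≠ 0 → γ ≠ 0 →
    (((A ×ˢ A).filter (fun p => α * p.1 + β * p.2 = γ)).card : ℝ) ≤ R

lemma card_le_of_forall_mem {β : Type*} [DecidableEq β] (Z : Finset β) (Q : Finset ℝ)
    {A : Finset ℝ} {R : ℝ} (hR : FewOnLines A R) {α β' : ℝ} (hα : α ≠ 0) (hβ : β' ≠ 0)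
    (γ : ℝ → ℝ) (hγ : ∀ x ∈ Q, γ x ≠ 0) (φ : ℝ → ℝ × ℝ → β)
    (hZ : ∀ z ∈ Z, ∃ x ∈ Q, ∃ p ∈ A ×ˢ A, α * p.1 + β' * p.2 = γ x ∧ φ x p = z) :
    (Z.card : ℝ) ≤ Q.card * R := by
  set F : ℝ → Finset β := fun x =>
    ((A ×ˢ A).filter (fun p => α * p.1 + β' * p.2 = γ x)).image (φ x) with hF
  have h1 : Z ⊆ Q.biUnion F := by
    intro z hz
    obtain ⟨x, hx, p, hp, he, rfl⟩ := hZ z hz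
    exact Finset.mem_biUnion.2 ⟨x, hx, Finset.mem_image_of_mem _ (Finset.mem_filter.2 ⟨hp, he⟩)⟩
  have h2 : (Z.card : ℝ) ≤ ∑ x ∈ Q, ((F x).card : ℝ) := by
    exact_mod_cast (Finset.card_le_card h1).trans Finset.card_biUnion_le
  refine h2.trans ?_
  have h3 : ∀ x ∈ Q, ((F x).card : ℝ) ≤ R := fun x hx =>
    le_trans (by exact_mod_cast Finset.card_image_le) (hR α β' (γ x) hα hβ (hγ x hx))
  simpa using Finset.sum_le_card_nsmul Q (fun x => ((F x).card : ℝ)) R h3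

lemma card_coneSum_inter_le {A : Finset ℝ} (hA : ∀ a ∈ A, 0 < a) {R : ℝ} (hR : FewOnLines A R)
    (X : ℝ → ℝ) {i j k l : ℝ} (hXi : 0 < X i) (hXk : 0 < X k) (hij : i ≠ j) (hil : i ≠ l)
    (hne : (i, j) ≠ (k, l)) :
    ((coneSum (A.image (· * X i)) (slopeFiber A j) i j ∩
      coneSum (A.image (· * X k)) (slopeFiber A l) k l).card : ℝ) ≤ (slopeFiber A j).card * R := by
  have hmem : ∀ {t x : ℝ}, x ∈ slopeFiber A t → x ∈ A := fun h => (Finset.mem_filter.1 h).1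
  have key : ∀ z ∈ coneSum (A.image (· * X i)) (slopeFiber A j) i j ∩
      coneSum (A.image (· * X k)) (slopeFiber A l) k l, ∃ a ∈ A, ∃ x ∈ slopeFiber A j, ∃ b ∈ A,
      ∃ y ∈ slopeFiber A l, z = (a * X i + x, i * (a * X i) + j * x) ∧
        a * X i + x = b * X k + y ∧ i * (a * X i) + j * x = k * (b * X k) + l * y := by
    intro z hz
    obtain ⟨h1, h2⟩ := Finset.mem_inter.1 hz
    obtain ⟨⟨u, x⟩, h, rfl⟩ := Finset.mem_image.1 h1
    obtain ⟨⟨v, y⟩, h', he⟩ := Finset.mem_image.1 h2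
    rw [Finset.mem_product] at h h'
    obtain ⟨a, ha, hau⟩ := Finset.mem_image.1 h.1
    obtain ⟨b, hb, hbv⟩ := Finset.mem_image.1 h'.1
    dsimp only at hau hbv
    subst hau hbv
    simp only [Prod.mk.injEq] at he
    exact ⟨a, ha, x, h.2, b, hb, y, h'.2, rfl, he.1.symm, he.2.symm⟩
  by_cases hik : i = k
  · subst hik
    have hjl : j ≠ l := fun h => hne (by rw [h])
    refine card_le_of_forall_mem _ (slopeFiber A j) hR (α := 1) (β' := -1) one_ne_zero
      (neg_ne_zero.2 one_ne_zero) (fun x => -(x * (j - l)) / (X i * (i - l))) (fun x hx => ?_)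
      (fun x p => (p.1 * X i + x, i * (p.1 * X i) + j * x)) fun z hz => ?_
    · exact div_ne_zero (neg_ne_zero.2 (mul_ne_zero (hA x (hmem hx)).ne' (sub_ne_zero.2 hjl)))
        (mul_ne_zero hXi.ne' (sub_ne_zero.2 hil))
    · obtain ⟨a, ha, x, hx, b, hb, y, hy, rfl, e1, e2⟩ := key z hz
      refine ⟨x, hx, (a, b), by simp [ha, hb], ?_, rfl⟩
      rw [eq_div_iff (mul_ne_zero hXi.ne' (sub_ne_zero.2 hil))]
      linear_combination e2 - l * e1
  · refine card_le_of_forall_mem _ (slopeFiber A j) hR (α := X k * (k - i)) (β' := l - i)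
      (mul_ne_zero hXk.ne' (sub_ne_zero.2 (Ne.symm hik))) (sub_ne_zero.2 hil.symm)
      (fun x => x * (j - i)) (fun x hx => ?_)
      (fun x p => (p.1 * X k + p.2, k * (p.1 * X k) + l * p.2)) fun z hz => ?_
    · exact mul_ne_zero (hA x (hmem hx)).ne' (sub_ne_zero.2 hij.symm)
    · obtain ⟨a, ha, x, hx, b, hb, y, hy, rfl, e1, e2⟩ := key z hz
      refine ⟨x, hx, (b, y), by simp [hb, hmem hy], ?_, by rw [e1, e2]⟩
      linear_combination i * e1 - e2

/-- Sums of points on many lines close to each other. -/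
theorem exists_cluster_sums {A : Finset ℝ} (hA : ∀ a ∈ A, 0 < a) {R : ℝ} (hR0 : 0 ≤ R)
    (hR : FewOnLines A R) {M : ℕ} (hMR : (M : ℝ) ^ 2 * R ≤ A.card / 2) {I J : Finset ℝ}
    (hI : I ⊆ slopeSet A) (hIM : I.card = M) (hJM : J.card = M)
    (hIJ : Disjoint I J) :
    ∃ U ⊆ mulAddSet A ×ˢ mulAddSet A, InCone U (I ∪ J) ∧
      M * (A.card / 2 : ℝ) * ∑ t ∈ J, ((slopeFiber A t).card : ℝ) ≤ U.card := by
  have hX : ∀ t, ∃ x, t ∈ I → x ∈ slopeFiber A t := by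
    intro t
    by_cases ht : t ∈ I
    · obtain ⟨x, hx⟩ := slopeFiber_nonempty hA (hI ht)
      exact ⟨x, fun _ => hx⟩
    · exact ⟨0, fun h => absurd h ht⟩
  choose X hX using hX
  have hfib : ∀ {t x : ℝ}, x ∈ slopeFiber A t → 0 < x := fun h => hA _ (Finset.mem_filter.1 h).1
  have hXpos : ∀ t ∈ I, 0 < X t := fun t ht => hfib (hX t ht)
  have hne : ∀ i ∈ I, ∀ j ∈ J, i ≠ j := fun i hi j hj h =>
    Finset.disjoint_left.1 hIJ hi (h ▸ hj)
  have himage : ∀ i ∈ I, (A.image (· * X i)).card = A.card := fun i hi =>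
    Finset.card_image_of_injective _ (mul_left_injective₀ (hXpos i hi).ne')
  set U : ℝ × ℝ → Finset (ℝ × ℝ) := fun e =>
    coneSum (A.image (· * X e.1)) (slopeFiber A e.2) e.1 e.2 with hU
  refine ⟨(I ×ˢ J).biUnion U, ?_, ?_, ?_⟩
  · refine Finset.biUnion_subset.2 fun e he => coneSum_subset ?_
    rw [Finset.mem_product] at he
    intro u hu
    obtain ⟨a, ha, rfl⟩ := Finset.mem_image.1 hu
    exact Finset.mem_image.2 ⟨(a, X e.1), Finset.mem_product.2 ⟨ha, hX _ he.1⟩, rfl⟩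
  · intro p hp
    obtain ⟨e, he, hpe⟩ := Finset.mem_biUnion.1 hp
    rw [Finset.mem_product] at he
    refine inCone_coneSum ?_ (fun a ha => hfib ha) (hne _ he.1 _ he.2)
      (Finset.mem_union_left _ he.1) (Finset.mem_union_right _ he.2) p hpe
    intro u hu
    obtain ⟨a, ha, rfl⟩ := Finset.mem_image.1 hu
    exact mul_pos (hA a ha) (hXpos _ he.1)
  · refine le_trans ?_ (sum_card_sub_le_card_biUnion (I ×ˢ J) U
      (fun e => (slopeFiber A e.2).card * R) (fun e _ => by positivity) ?_)
    · have h1 : ∀ e ∈ I ×ˢ J, (A.card / 2 : ℝ) * (slopeFiber A e.2).card ≤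
          (U e).card - (I ×ˢ J).card * ((slopeFiber A e.2).card * R) := by
        intro e he
        rw [Finset.mem_product] at he
        rw [hU, card_coneSum _ _ (hne _ he.1 _ he.2), himage _ he.1, Finset.card_product, hIM, hJM]
        push_cast
        have := mul_le_mul_of_nonneg_right hMR (Nat.cast_nonneg (α := ℝ) (slopeFiber A e.2).card)
        linarith
      refine le_trans (le_of_eq ?_) (Finset.sum_le_sum h1)
      rw [Finset.sum_product]
      simp only [← Finset.mul_sum, Finset.sum_const, hIM, nsmul_eq_mul]
      ring
    · rintro ⟨i, j⟩ he ⟨k, l⟩ hf hef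
      rw [Finset.mem_product] at he hf
      exact card_coneSum_inter_le hA hR X (hXpos _ he.1) (hXpos _ hf.1) (hne _ he.1 _ he.2)
        (hne _ he.1 _ hf.2) hef

/-- If `AA + A` is small, then some line through the origin contains many points of `A × A`, and
their abscissae have a small product set with `A`. -/
theorem exists_rich_slope {A : Finset ℝ} (hA : ∀ a ∈ A, 0 < a) {K s : ℝ} (hK : 1 ≤ K) (hs : 8 ≤ s)
    (hn : s ^ 9 = A.card) (hS : ((mulAddSet A).card : ℝ) ^ 2 ≤ K * (A.card : ℝ) ^ 3) :
    ∃ t, s ^ 6 / (1960 * K ^ 2) ≤ (slopeFiber A t).card ∧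
      (((A ×ˢ slopeFiber A t).image (fun p => p.1 * p.2)).card : ℝ) ≤ 5 * K * A.card := by
  by_contra! hcon
  have hd := card_slopeSet_le hA hK (by linarith) hn hS
  have hs1 : 1 ≤ s := by linarith
  have hn8 : (8 : ℝ) ≤ A.card := by
    rw [← hn]
    exact hs.trans (le_self_pow₀ hs1 (by norm_num))
  set D := (slopeSet A).filter (fun t => s ^ 6 / (1960 * K ^ 2) ≤ (slopeFiber A t).card) with hD
  have hfib : ∀ {t x : ℝ}, x ∈ slopeFiber A t → 0 < x := fun h => hA _ (Finset.mem_filter.1 h).1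
  have hle : ∀ t, (slopeFiber A t).card ≤ A.card := fun t =>
    Finset.card_le_card (Finset.filter_subset _ _)
  obtain ⟨V, hVT, -, hV⟩ := mul_sum_sub_le_card_of_blocks (fun t => ((slopeFiber A t).card : ℝ))
    (n := A.card) (κ := 5 * K * A.card / 2) (by positivity) (M := 2) (by norm_num) D
    (fun t _ => by exact_mod_cast hle t) (by positivity) (mulAddSet A ×ˢ mulAddSet A) (by
      intro B hB hB2
      have hpair : ∀ i ∈ B, ∀ j ∈ B, i ≠ j →
          (slopeFiber A i).card ≤ (slopeFiber A j).card →
          ∑ t ∈ B, ((slopeFiber A t).card : ℝ) =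
            (slopeFiber A i).card + (slopeFiber A j).card →
          ∃ U ⊆ mulAddSet A ×ˢ mulAddSet A, InCone U B ∧
            5 * K * A.card / 2 * ∑ t ∈ B, ((slopeFiber A t).card : ℝ) ≤ U.card := by
        intro i hi j hj hij hw hsum
        refine ⟨coneSum ((A ×ˢ slopeFiber A i).image (fun p => p.1 * p.2)) (slopeFiber A j) i j,
          coneSum_subset (Finset.Subset.refl _), inCone_coneSum ?_ (fun a ha => hfib ha) hij hi hj,
          ?_⟩
        · intro u hu
          obtain ⟨p, hp, rfl⟩ := Finset.mem_image.1 hu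
          rw [Finset.mem_product] at hp
          exact mul_pos (hA _ hp.1) (hfib hp.2)
        · rw [card_coneSum _ _ hij, hsum]
          have h1 := (hcon i (Finset.mem_filter.1 (hB hi)).2).le
          have h2 : ((slopeFiber A i).card : ℝ) ≤ (slopeFiber A j).card := by exact_mod_cast hw
          push_cast
          calc 5 * K * A.card / 2 * (((slopeFiber A i).card : ℝ) + (slopeFiber A j).card)
              ≤ 5 * K * A.card / 2 * (((slopeFiber A j).card : ℝ) + (slopeFiber A j).card) := by
                gcongr
            _ = 5 * K * A.card * (slopeFiber A j).card := by ring
            _ ≤ _ := by gcongr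
      obtain ⟨i, j, hij, rfl⟩ := Finset.card_eq_two.1 hB2
      rcases le_total (slopeFiber A i).card (slopeFiber A j).card with h | h
      · exact hpair i (by simp) j (by simp) hij h (Finset.sum_pair hij)
      · exact hpair j (by simp) i (by simp) hij.symm h
          ((Finset.sum_pair hij).trans (add_comm _ _)))
  have hVc : (V.card : ℝ) ≤ ((mulAddSet A).card : ℝ) ^ 2 := by
    have := Finset.card_le_card hVT
    rw [Finset.card_product, ← sq] at this
    exact_mod_cast this
  have hall : ∑ t ∈ slopeSet A, ((slopeFiber A t).card : ℝ) = (A.card : ℝ) ^ 2 := by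
    exact_mod_cast sum_card_slopeFiber hA
  have hpoor : ∑ t ∈ (slopeSet A).filter
      (fun t => ¬ s ^ 6 / (1960 * K ^ 2) ≤ (slopeFiber A t).card), ((slopeFiber A t).card : ℝ) ≤
      (A.card : ℝ) ^ 2 / 4 := by
    have h1 := Finset.sum_le_card_nsmul ((slopeSet A).filter
      (fun t => ¬ s ^ 6 / (1960 * K ^ 2) ≤ (slopeFiber A t).card))
      (fun t => ((slopeFiber A t).card : ℝ)) (s ^ 6 / (1960 * K ^ 2))
      (fun t ht => (not_le.1 (Finset.mem_filter.1 ht).2).le)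
    rw [nsmul_eq_mul] at h1
    refine h1.trans ?_
    have h2 : (((slopeSet A).filter
      (fun t => ¬ s ^ 6 / (1960 * K ^ 2) ≤ (slopeFiber A t).card)).card : ℝ) ≤
      (slopeSet A).card := by exact_mod_cast Finset.card_le_card (Finset.filter_subset _ _)
    calc _ ≤ (490 * K ^ 2 * s ^ 12) * (s ^ 6 / (1960 * K ^ 2)) := by
          gcongr
          exact h2.trans hd
      _ = (s ^ 9) ^ 2 / 4 := by
          field_simp
          ring
      _ = _ := by rw [hn]
  have hsplit := Finset.sum_filter_add_sum_filter_not (slopeSet A)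
    (fun t => s ^ 6 / (1960 * K ^ 2) ≤ (slopeFiber A t).card)
    (fun t => ((slopeFiber A t).card : ℝ))
  rw [hall, ← hD] at hsplit
  have h1 : (A.card : ℝ) ^ 2 / 2 ≤ ∑ t ∈ D, ((slopeFiber A t).card : ℝ) - (2 : ℕ) * A.card := by
    push_cast
    nlinarith
  have h2 : 5 * K * A.card / 2 * ((A.card : ℝ) ^ 2 / 2) ≤ K * (A.card : ℝ) ^ 3 :=
    (mul_le_mul_of_nonneg_left h1 (by positivity)).trans (hV.trans (hVc.trans hS))
  have h3 : 0 < K * (A.card : ℝ) ^ 3 := by positivity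
  nlinarith

/-- If `AA + A` is small, then lines in general position contain few points of `A × A`. -/
theorem fewOnLines_of_card_mulAddSet_le {A : Finset ℝ} (hA : ∀ a ∈ A, 0 < a) {K s : ℝ}
    (hK : 1 ≤ K) (hs : 8 ≤ s) (hn : s ^ 9 = A.card)
    (hS : ((mulAddSet A).card : ℝ) ^ 2 ≤ K * (A.card : ℝ) ^ 3) :
    FewOnLines A (7300 * K ^ 3 * s ^ 8) := by
  obtain ⟨t, ht, hprod⟩ := exists_rich_slope hA hK hs hn hS
  have hs1 : 1 ≤ s := by linarith
  have hK3 : 1 ≤ K ^ 3 := one_le_pow₀ hK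
  have hs8 : 1 ≤ s ^ 8 := one_le_pow₀ hs1
  intro α β γ hα hβ hγ
  rcases Nat.lt_or_ge ((A ×ˢ A).filter (fun p => α * p.1 + β * p.2 = γ)).card 4 with h | h
  · have h4 : (((A ×ˢ A).filter (fun p => α * p.1 + β * p.2 = γ)).card : ℝ) < 4 := by
      exact_mod_cast h
    nlinarith
  have key := card_solutions_le (H := slopeFiber A t) (fun a ha => hA a (Finset.mem_filter.1 ha).1)
    le_rfl hα hβ hγ h
  have hm0 : (0 : ℝ) ≤ (((A ×ˢ slopeFiber A t).image (fun p => p.1 * p.2)).card : ℝ) :=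
    Nat.cast_nonneg _
  generalize (((A ×ˢ A).filter (fun p => α * p.1 + β * p.2 = γ)).card : ℝ) = r at *
  generalize (((A ×ˢ slopeFiber A t).image (fun p => p.1 * p.2)).card : ℝ) = m at *
  by_contra! hlt
  have hr : (7300 * K ^ 3 * s ^ 8) ^ 3 < r ^ 3 := by gcongr
  rw [← hn] at hprod
  have hm4 : m ^ 4 ≤ (5 * K * s ^ 9) ^ 4 := by gcongr
  have h5 : (s ^ 6 / (1960 * K ^ 2)) ^ 2 * (7300 * K ^ 3 * s ^ 8) ^ 3 <
      162 * (5 * K * s ^ 9) ^ 4 := by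
    calc (s ^ 6 / (1960 * K ^ 2)) ^ 2 * (7300 * K ^ 3 * s ^ 8) ^ 3
        < (s ^ 6 / (1960 * K ^ 2)) ^ 2 * r ^ 3 := by gcongr
      _ ≤ ((slopeFiber A t).card : ℝ) ^ 2 * r ^ 3 := by
          have : 0 ≤ r ^ 3 := le_trans (by positivity) hr.le
          gcongr
      _ ≤ 162 * m ^ 4 := key
      _ ≤ _ := by gcongr
  have e1 : (s ^ 6 / (1960 * K ^ 2)) ^ 2 * (7300 * K ^ 3 * s ^ 8) ^ 3 =
      (7300 ^ 3 / 1960 ^ 2) * (K ^ 5 * s ^ 36) := by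
    field_simp
  have e2 : 162 * (5 * K * s ^ 9) ^ 4 = 101250 * (K ^ 4 * s ^ 36) := by ring
  rw [e1, e2] at h5
  have h6 : K ^ 4 * s ^ 36 ≤ K ^ 5 * s ^ 36 := by
    gcongr
    norm_num
  have h7 : 0 < K ^ 5 * s ^ 36 := by positivity
  nlinarith

/-- A quantitative lower bound for `|AA + A|` for sets of positive reals. -/
theorem lt_card_mulAddSet_sq {A : Finset ℝ} (hA : ∀ a ∈ A, 0 < a) {K s : ℝ} (hK : 1 ≤ K)
    (hn : s ^ 9 = A.card) (hKs : 2000000 * K ^ 5 ≤ s) :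
    K * (A.card : ℝ) ^ 3 < ((mulAddSet A).card : ℝ) ^ 2 := by
  by_contra! hS
  have hK5 : K ≤ K ^ 5 := le_self_pow₀ hK (by norm_num)
  have hs : 8 ≤ s := by linarith
  have hs1 : 1 ≤ s := by linarith
  have hfew := fewOnLines_of_card_mulAddSet_le hA hK hs hn hS
  have hsn : s ≤ A.card := by
    rw [← hn]
    exact le_self_pow₀ hs1 (by norm_num)
  set M : ℕ := ⌈9 * K⌉₊ with hM
  have hM1 : 9 * K ≤ M := Nat.le_ceil _
  have hM2 : (M : ℝ) ≤ 10 * K := by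
    have : (M : ℝ) < 9 * K + 1 := Nat.ceil_lt_add_one (by positivity)
    linarith
  have hM0 : 0 < M := by
    have : (0 : ℝ) < M := by linarith
    exact_mod_cast this
  have hMR : (M : ℝ) ^ 2 * (7300 * K ^ 3 * s ^ 8) ≤ A.card / 2 := by
    calc (M : ℝ) ^ 2 * (7300 * K ^ 3 * s ^ 8) ≤ (10 * K) ^ 2 * (7300 * K ^ 3 * s ^ 8) := by gcongr
      _ = (730000 * K ^ 5) * s ^ 8 := by ring
      _ ≤ (s / 2) * s ^ 8 := by
          gcongr
          nlinarith [pow_pos (by linarith : 0 < K) 5]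
      _ = s ^ 9 / 2 := by ring
      _ = _ := by rw [hn]
  have hle : ∀ t, (slopeFiber A t).card ≤ A.card := fun t =>
    Finset.card_le_card (Finset.filter_subset _ _)
  obtain ⟨V, hVT, -, hV⟩ := mul_sum_sub_le_card_of_blocks (fun t => ((slopeFiber A t).card : ℝ))
    (n := A.card) (κ := M * A.card / 4) (by positivity) (M := 2 * M) (by omega) (slopeSet A)
    (fun t _ => by exact_mod_cast hle t) (by positivity) (mulAddSet A ×ˢ mulAddSet A) (by
      intro B hB hBc
      obtain ⟨I, hIB, hI⟩ := Finset.exists_subset_card_eq (s := B) (n := M) (by omega)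
      have hJ : (B \ I).card = M := by
        rw [Finset.card_sdiff_of_subset hIB]
        omega
      have hsum := Finset.sum_sdiff (f := fun t => ((slopeFiber A t).card : ℝ)) hIB
      rcases le_total (∑ t ∈ I, ((slopeFiber A t).card : ℝ))
        (∑ t ∈ B \ I, ((slopeFiber A t).card : ℝ)) with h | h
      · obtain ⟨U, hU, hUB, hUc⟩ := exists_cluster_sums hA (by positivity) hfew hMR
          (hIB.trans hB) hI hJ Finset.disjoint_sdiff
        rw [Finset.union_sdiff_of_subset hIB] at hUB
        refine ⟨U, hU, hUB, le_trans ?_ hUc⟩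
        calc M * A.card / 4 * ∑ t ∈ B, ((slopeFiber A t).card : ℝ)
            ≤ M * A.card / 4 * (2 * ∑ t ∈ B \ I, ((slopeFiber A t).card : ℝ)) := by
              gcongr
              linarith
          _ = _ := by ring
      · obtain ⟨U, hU, hUB, hUc⟩ := exists_cluster_sums hA (by positivity) hfew hMR
          (Finset.sdiff_subset.trans hB) hJ hI Finset.sdiff_disjoint
        rw [Finset.sdiff_union_of_subset hIB] at hUB
        refine ⟨U, hU, hUB, le_trans ?_ hUc⟩
        calc M * A.card / 4 * ∑ t ∈ B, ((slopeFiber A t).card : ℝ)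
            ≤ M * A.card / 4 * (2 * ∑ t ∈ I, ((slopeFiber A t).card : ℝ)) := by
              gcongr
              linarith
          _ = _ := by ring)
  have hVc : (V.card : ℝ) ≤ ((mulAddSet A).card : ℝ) ^ 2 := by
    have := Finset.card_le_card hVT
    rw [Finset.card_product, ← sq] at this
    exact_mod_cast this
  have hall : ∑ t ∈ slopeSet A, ((slopeFiber A t).card : ℝ) = (A.card : ℝ) ^ 2 := by
    exact_mod_cast sum_card_slopeFiber hA
  rw [hall] at hV
  have hn0 : (0 : ℝ) < A.card := by linarith
  have h1 : (A.card : ℝ) ^ 2 / 2 ≤ (A.card : ℝ) ^ 2 - (2 * M : ℕ) * A.card := by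
    push_cast
    nlinarith
  have h2 : M * A.card / 4 * ((A.card : ℝ) ^ 2 / 2) ≤ K * (A.card : ℝ) ^ 3 :=
    (mul_le_mul_of_nonneg_left h1 (by positivity)).trans (hV.trans (hVc.trans hS))
  have h3 : (9 * K) * (A.card : ℝ) ^ 3 ≤ M * (A.card : ℝ) ^ 3 := by gcongr
  have h4 : 0 < K * (A.card : ℝ) ^ 3 := by positivity
  nlinarith

/-- The lower bound for `|AA + A|` for sets of positive reals, as a power of `|A|`. -/
theorem rpow_le_card_mulAddSet {A : Finset ℝ} (hA : ∀ a ∈ A, 0 < a)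
    (hn : (2000000 : ℝ) ^ 9 ≤ A.card) :
    (2000000 : ℝ) ^ (-(1 / 10) : ℝ) * (A.card : ℝ) ^ ((3 : ℝ) / 2 + 1 / 90) ≤
      (mulAddSet A).card := by
  have hn0 : (0 : ℝ) < A.card := lt_of_lt_of_le (by positivity) hn
  set s : ℝ := (A.card : ℝ) ^ ((1 : ℝ) / 9) with hs
  have hs0 : 0 < s := by positivity
  have hs9 : s ^ 9 = A.card := by
    rw [hs, ← Real.rpow_natCast, ← Real.rpow_mul hn0.le]
    norm_num
  have hsQ : 2000000 ≤ s := by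
    refine le_of_pow_le_pow_left₀ (n := 9) (by norm_num) hs0.le ?_
    rwa [hs9]
  set K : ℝ := (s / 2000000) ^ ((1 : ℝ) / 5) with hKdef
  have hK : 1 ≤ K := Real.one_le_rpow (by rw [le_div_iff₀] <;> linarith) (by norm_num)
  have hK5 : K ^ 5 = s / 2000000 := by
    rw [hKdef, ← Real.rpow_natCast, ← Real.rpow_mul (by positivity)]
    norm_num
  have h := (lt_card_mulAddSet_sq hA hK hs9 (by rw [hK5]; linarith)).le
  refine le_of_sq_le_sq ?_ (by positivity)
  refine le_trans (le_of_eq ?_) h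
  have e1 : ((2000000 : ℝ) ^ (-(1 / 10) : ℝ)) ^ 2 = (2000000 : ℝ) ^ (-(1 / 5) : ℝ) := by
    rw [← Real.rpow_natCast, ← Real.rpow_mul (by norm_num)]
    norm_num
  have e2 : ((A.card : ℝ) ^ ((3 : ℝ) / 2 + 1 / 90)) ^ 2 =
      (A.card : ℝ) ^ ((1 : ℝ) / 45) * (A.card : ℝ) ^ 3 := by
    rw [← Real.rpow_natCast, ← Real.rpow_natCast, ← Real.rpow_mul hn0.le, ← Real.rpow_add hn0]
    norm_num
  have e3 : K = (2000000 : ℝ) ^ (-(1 / 5) : ℝ) * (A.card : ℝ) ^ ((1 : ℝ) / 45) := by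
    rw [hKdef, Real.div_rpow hs0.le (by norm_num), hs, ← Real.rpow_mul hn0.le,
      Real.rpow_neg (by norm_num)]
    norm_num
    ring
  rw [mul_pow, e1, e2, e3]
  ring

/-- There is `c > 0` such that for every `0 < δ ≤ 1` there are `C > 0` and `n₀ ≥ 1`:
for every finite set `A` of reals with `|A| ≥ n₀` having at least `δ·|A|` strictly
positive elements, `|AA+A| ≥ C·|A|^(3/2 + c)`. -/
theorem lower_bound_AA_add_A_of_positive_proportion :
    ∃ c : ℝ, 0 < c ∧
      ∀ δ : ℝ, 0 < δ → δ ≤ 1 →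
        ∃ C : ℝ, 0 < C ∧ ∃ n₀ : ℕ, 0 < n₀ ∧
          ∀ A : Finset ℝ, n₀ ≤ A.card →
            δ * (A.card : ℝ) ≤ ((A.filter (fun a => 0 < a)).card : ℝ) →
            C * (A.card : ℝ) ^ ((3 : ℝ) / 2 + c) ≤
              (((A ×ˢ A ×ˢ A).image
                (fun p : ℝ × ℝ × ℝ => p.1 * p.2.1 + p.2.2)).card : ℝ) := by
  refine ⟨1 / 90, by norm_num, fun δ hδ _ =>
    ⟨(2000000 : ℝ) ^ (-(1 / 10) : ℝ) * δ ^ ((3 : ℝ) / 2 + 1 / 90), by positivity,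
      ⌈(2000000 : ℝ) ^ 9 / δ⌉₊, Nat.ceil_pos.2 (by positivity), fun A hA hδA => ?_⟩⟩
  have hA' : (2000000 : ℝ) ^ 9 / δ ≤ A.card := Nat.ceil_le.1 hA
  rw [div_le_iff₀ hδ] at hA'
  have h := rpow_le_card_mulAddSet (A := A.filter (fun a => 0 < a))
    (fun a ha => (Finset.mem_filter.1 ha).2) (by linarith)
  have hsub : mulAddSet (A.filter (fun a => 0 < a)) ⊆ mulAddSet A := by
    have := Finset.filter_subset (fun a => 0 < a) A
    exact Finset.image_subset_image
      (Finset.product_subset_product this (Finset.product_subset_product this this))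
  calc (2000000 : ℝ) ^ (-(1 / 10) : ℝ) * δ ^ ((3 : ℝ) / 2 + 1 / 90) *
        (A.card : ℝ) ^ ((3 : ℝ) / 2 + 1 / 90)
      = (2000000 : ℝ) ^ (-(1 / 10) : ℝ) * (δ * A.card) ^ ((3 : ℝ) / 2 + 1 / 90) := by
        rw [Real.mul_rpow hδ.le (by positivity)]
        ring
    _ ≤ (2000000 : ℝ) ^ (-(1 / 10) : ℝ) *
        ((A.filter (fun a => 0 < a)).card : ℝ) ^ ((3 : ℝ) / 2 + 1 / 90) := by gcongr
    _ ≤ (mulAddSet (A.filter (fun a => 0 < a))).card := h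
    _ ≤ (mulAddSet A).card := by exact_mod_cast Finset.card_le_card hsub
end

section
/- There exists a real constant c > 0 such that for every δ with 0 < δ ≤ 1 there exist a constant C > 0 and a positive integer n₀ with the following property: for every finite set A of real numbers with |A| ≥ n₀ such that at least δ·|A| elements of A are strictly negative, one has |AA−A| ≥ C·|A|^(3/2 + c). -/
namespace SumProduct

open Finset
open scoped Pointwise

/-- Cauchy–Schwarz: a map with few collisions has a large image. -/
lemma card_sq_le_card_mul_collisions {α β : Type*} [DecidableEq β] (D : Finset α) (W : Finset β)
    (f : α → β) (hf : ∀ d ∈ D, f d ∈ W) :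
    #D ^ 2 ≤ #W * #{p ∈ D ×ˢ D | f p.1 = f p.2} := by
  have h1 : #D = ∑ w ∈ W, #{d ∈ D | f d = w} := card_eq_sum_card_fiberwise hf
  have h2 : #{p ∈ D ×ˢ D | f p.1 = f p.2} = ∑ w ∈ W, #{d ∈ D | f d = w} ^ 2 := by
    rw [card_eq_sum_card_fiberwise (f := fun p : α × α => f p.1) (t := W)]
    · refine sum_congr rfl fun w _ => ?_
      rw [sq, ← card_product]
      congr 1
      ext ⟨a, b⟩
      simp only [mem_filter, mem_product]
      constructor
      · rintro ⟨⟨⟨ha, hb⟩, h⟩, hw⟩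
        exact ⟨⟨ha, hw⟩, hb, h ▸ hw⟩
      · rintro ⟨⟨ha, hw⟩, hb, h⟩
        exact ⟨⟨⟨ha, hb⟩, hw.trans h.symm⟩, hw⟩
    · rintro ⟨a, b⟩ h
      simp only [coe_filter, mem_product, Set.mem_ofPred_eq] at h
      exact hf _ h.1.1
  rw [h2]
  nth_rewrite 1 [h1]
  exact sq_sum_le_card_mul_sum_sq

lemma card_le_card_image_add_collisions {α β : Type*} [DecidableEq α] [DecidableEq β]
    (D : Finset α) (f : α → β) :
    #D ≤ #(D.image f) + #{p ∈ D ×ˢ D | p.1 ≠ p.2 ∧ f p.1 = f p.2} := by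
  classical
  induction D using Finset.induction_on with
  | empty => simp
  | insert a D ha ih =>
    rw [card_insert_of_notMem ha]
    by_cases hm : f a ∈ D.image f
    · obtain ⟨b, hb, hab⟩ := mem_image.1 hm
      rw [image_insert, insert_eq_self.2 hm]
      have : insert (a, b) {p ∈ D ×ˢ D | p.1 ≠ p.2 ∧ f p.1 = f p.2} ⊆
          {p ∈ insert a D ×ˢ insert a D | p.1 ≠ p.2 ∧ f p.1 = f p.2} := by
        intro p hp
        rw [mem_insert] at hp
        rcases hp with rfl | hp
        · have : a ≠ b := fun h => ha (h ▸ hb)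
          simp [hb, hab, this]
        · simp only [mem_filter, mem_product, mem_insert] at hp ⊢
          exact ⟨⟨Or.inr hp.1.1, Or.inr hp.1.2⟩, hp.2⟩
      have h2 := card_le_card this
      rw [card_insert_of_notMem (by simp [ha])] at h2
      omega
    · rw [image_insert, card_insert_of_notMem hm]
      have : #{p ∈ D ×ˢ D | p.1 ≠ p.2 ∧ f p.1 = f p.2} ≤
          #{p ∈ insert a D ×ˢ insert a D | p.1 ≠ p.2 ∧ f p.1 = f p.2} := by
        apply card_le_card
        gcongr <;> exact subset_insert _ _
      omega

/-- The index of the block of length `s` containing `x` when `S` is cut in increasing order. -/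
noncomputable def block (S : Finset ℝ) (s : ℕ) (x : ℝ) : ℕ := #{y ∈ S | y < x} / s

lemma block_mono (S : Finset ℝ) (s : ℕ) : Monotone (block S s) := fun x y h => by
  unfold block
  gcongr

lemma block_lt {S : Finset ℝ} {r s : ℕ} (h : #S ≤ r * s) {x : ℝ} (hx : x ∈ S) :
    block S s x < r := by
  apply Nat.div_lt_of_lt_mul
  rw [mul_comm]
  refine lt_of_lt_of_le (card_lt_card ?_) h
  exact filter_ssubset.2 ⟨x, hx, lt_irrefl x⟩

lemma card_block_le {S : Finset ℝ} {r s : ℕ} (h : #S ≤ r * s) (i : ℕ) :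
    #{x ∈ S | block S s x = i} ≤ s := by
  rcases Nat.eq_zero_or_pos s with rfl | hs
  · have : S = ∅ := by simpa using h
    simp [this]
  calc _ ≤ #(range s) := by
        refine card_le_card_of_injOn (fun x => #{y ∈ S | y < x} % s)
          (fun x _ => by simpa using Nat.mod_lt _ hs) ?_
        intro x hx y hy hxy
        rw [mem_coe, mem_filter] at hx hy
        simp only [block] at hx hy
        beta_reduce at hxy
        have e : #{z ∈ S | z < x} = #{z ∈ S | z < y} := by
          rw [← Nat.div_add_mod (#{z ∈ S | z < x}) s, hx.2, hxy, ← hy.2, Nat.div_add_mod]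
        by_contra hne
        rcases lt_or_gt_of_ne hne with hlt | hlt
        · refine (card_lt_card (?_ : {z ∈ S | z < x} ⊂ {z ∈ S | z < y})).ne e
          refine (ssubset_iff_of_subset fun z hz => ?_).2 ⟨x, by simp [hx.1, hlt], by simp⟩
          simp only [mem_filter] at hz ⊢
          exact ⟨hz.1, hz.2.trans hlt⟩
        · refine (card_lt_card (?_ : {z ∈ S | z < y} ⊂ {z ∈ S | z < x})).ne' e
          refine (ssubset_iff_of_subset fun z hz => ?_).2 ⟨y, by simp [hy.1, hlt], by simp⟩
          simp only [mem_filter] at hz ⊢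
          exact ⟨hz.1, hz.2.trans hlt⟩
    _ = s := card_range s

/-- A line meets at most `2 * r` cells of an `r × r` grid. -/
lemma card_cells_le {S T : Finset ℝ} {r s t : ℕ} (hs : #S ≤ r * s) (ht : #T ≤ r * t) (m b : ℝ) :
    #({x ∈ S | m * x + b ∈ T}.image fun x => (block S s x, block T t (m * x + b))) ≤ 2 * r := by
  rcases le_total 0 m with hm | hm
  · calc _ ≤ #(range (2 * r)) := by
          refine card_le_card_of_injOn (fun c => c.1 + c.2) ?_ ?_
          · intro c hc
            simp only [coe_image, coe_filter, Set.mem_image, Set.mem_ofPred_eq] at hc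
            obtain ⟨x, ⟨hx, hy⟩, rfl⟩ := hc
            have := block_lt hs hx
            have := block_lt ht hy
            simp only [coe_range, Set.mem_Iio]
            omega
          · intro c hc d hd hcd
            simp only [coe_image, coe_filter, Set.mem_image, Set.mem_ofPred_eq] at hc hd
            obtain ⟨x, -, rfl⟩ := hc
            obtain ⟨y, -, rfl⟩ := hd
            simp only at hcd
            rcases le_total x y with h | h
            · have h1 := block_mono S s h
              have h2 := block_mono T t (by gcongr : m * x + b ≤ m * y + b)
              exact Prod.ext (by simp only; omega) (by simp only; omega)
            · have h1 := block_mono S s h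
              have h2 := block_mono T t (by gcongr : m * y + b ≤ m * x + b)
              exact Prod.ext (by simp only; omega) (by simp only; omega)
      _ = 2 * r := card_range _
  · calc _ ≤ #(range (2 * r)) := by
          refine card_le_card_of_injOn (fun c => c.1 + (r - c.2)) ?_ ?_
          · intro c hc
            simp only [coe_image, coe_filter, Set.mem_image, Set.mem_ofPred_eq] at hc
            obtain ⟨x, ⟨hx, hy⟩, rfl⟩ := hc
            have := block_lt hs hx
            have := block_lt ht hy
            simp only [coe_range, Set.mem_Iio]
            omega
          · intro c hc d hd hcd
            simp only [coe_image, coe_filter, Set.mem_image, Set.mem_ofPred_eq] at hc hd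
            obtain ⟨x, ⟨-, hx⟩, rfl⟩ := hc
            obtain ⟨y, ⟨-, hy⟩, rfl⟩ := hd
            have h3 := block_lt ht hx
            have h4 := block_lt ht hy
            simp only at hcd
            rcases le_total x y with h | h
            · have h1 := block_mono S s h
              have h2 := block_mono T t
                (by linarith [mul_le_mul_of_nonpos_left h hm] : m * y + b ≤ m * x + b)
              exact Prod.ext (by simp only; omega) (by simp only; omega)
            · have h1 := block_mono S s h
              have h2 := block_mono T t
                (by linarith [mul_le_mul_of_nonpos_left h hm] : m * x + b ≤ m * y + b)
              exact Prod.ext (by simp only; omega) (by simp only; omega)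
      _ = 2 * r := card_range _

/-- Szemerédi–Trotter type bound for the incidences between a grid `S × T` and a set `L` of lines
`y = m * x + b`, in terms of a subdivision of the grid into `r × r` cells. -/
lemma incidences_le_of_cells {S T : Finset ℝ} (L : Finset (ℝ × ℝ)) {r s t : ℕ}
    (hs : #S ≤ r * s) (ht : #T ≤ r * t) :
    #{q ∈ L ×ˢ S | q.1.1 * q.2 + q.1.2 ∈ T} ≤ 2 * r * #L + r ^ 2 * (s * t) ^ 2 := by
  classical
  set g : ℝ × ℝ → ℝ → ℕ × ℕ := fun l x => (block S s x, block T t (l.1 * x + l.2)) with hg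
  set P : ℝ × ℝ → Finset ℝ := fun l => {x ∈ S | l.1 * x + l.2 ∈ T} with hP
  set Q : ℝ × ℝ → Finset (ℝ × ℝ) :=
    fun l => {p ∈ P l ×ˢ P l | p.1 ≠ p.2 ∧ g l p.1 = g l p.2} with hQ
  set c : ℝ × ℝ → ℕ × ℕ := fun p => (block S s p.1, block T t p.2) with hc
  have h1 : #{q ∈ L ×ˢ S | q.1.1 * q.2 + q.1.2 ∈ T} = ∑ l ∈ L, #(P l) := by
    rw [← card_sigma]
    refine card_nbij' (fun q => ⟨q.1, q.2⟩) (fun q => (q.1, q.2)) ?_ ?_ ?_ ?_ <;>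
      simp +contextual [hP, Set.MapsTo, Set.LeftInvOn, Set.RightInvOn]
  have h2 : ∀ l ∈ L, #(P l) ≤ 2 * r + #(Q l) := fun l _ =>
    (card_le_card_image_add_collisions (P l) (g l)).trans
      (Nat.add_le_add_right (card_cells_le hs ht l.1 l.2) _)
  have h3 : ∑ l ∈ L, #(Q l) ≤ #{p ∈ (S ×ˢ T) ×ˢ (S ×ˢ T) | c p.1 = c p.2} := by
    rw [← card_sigma]
    refine card_le_card_of_injOn
      (fun q => ((q.2.1, q.1.1 * q.2.1 + q.1.2), (q.2.2, q.1.1 * q.2.2 + q.1.2))) ?_ ?_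
    · rintro ⟨l, x, y⟩ h
      simp only [hQ, hP, coe_sigma, Set.mem_sigma_iff, coe_filter, mem_product, mem_filter,
        Set.mem_ofPred_eq] at h ⊢
      obtain ⟨-, ⟨⟨hx, hx'⟩, hy, hy'⟩, -, h⟩ := h
      exact ⟨⟨⟨hx, hx'⟩, hy, hy'⟩, h⟩
    · rintro ⟨⟨m, b⟩, x, y⟩ h ⟨⟨m', b'⟩, x', y'⟩ h' e
      simp only [hQ, coe_sigma, Set.mem_sigma_iff, coe_filter, Set.mem_ofPred_eq] at h
      simp only [Prod.mk.injEq] at e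
      obtain ⟨⟨rfl, e1⟩, rfl, e2⟩ := e
      have hne : x - y ≠ 0 := sub_ne_zero.2 h.2.2.1
      have hm : m = m' := by
        apply mul_right_cancel₀ hne
        linarith
      subst hm
      have hb : b = b' := by linarith
      subst hb
      rfl
  have h4 : #{p ∈ (S ×ˢ T) ×ˢ (S ×ˢ T) | c p.1 = c p.2} ≤ r ^ 2 * (s * t) ^ 2 := by
    have hmaps : ∀ p ∈ ({p ∈ (S ×ˢ T) ×ˢ (S ×ˢ T) | c p.1 = c p.2} : Finset _),
        c p.1 ∈ range r ×ˢ range r := by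
      intro p hp
      simp only [mem_filter, mem_product, mem_range] at hp ⊢
      exact ⟨block_lt hs hp.1.1.1, block_lt ht hp.1.1.2⟩
    rw [card_eq_sum_card_fiberwise hmaps]
    calc _ ≤ ∑ _i ∈ range r ×ˢ range r, (s * t) ^ 2 := by
          refine sum_le_sum fun i _ => ?_
          calc _ ≤ #(({x ∈ S | block S s x = i.1} ×ˢ {y ∈ T | block T t y = i.2}) ×ˢ
                ({x ∈ S | block S s x = i.1} ×ˢ {y ∈ T | block T t y = i.2})) := by
                apply card_le_card
                rintro ⟨⟨x, y⟩, x', y'⟩ h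
                simp only [hc, mem_filter, mem_product, Prod.mk.injEq] at h ⊢
                obtain ⟨⟨⟨⟨hx, hy⟩, hx', hy'⟩, e1, e2⟩, rfl⟩ := h
                exact ⟨⟨⟨hx, rfl⟩, hy, rfl⟩, ⟨hx', e1.symm⟩, hy', e2.symm⟩
            _ ≤ (s * t) ^ 2 := by
                simp only [card_product]
                rw [← sq]
                gcongr
                · exact card_block_le hs _
                · exact card_block_le ht _
      _ = r ^ 2 * (s * t) ^ 2 := by simp [sq]
  rw [h1]
  calc _ ≤ ∑ l ∈ L, (2 * r + #(Q l)) := sum_le_sum h2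
    _ = 2 * r * #L + ∑ l ∈ L, #(Q l) := by
        rw [sum_add_distrib, sum_const, smul_eq_mul, mul_comm]
    _ ≤ _ := by gcongr; exact h3.trans h4

lemma incidences_le {S T : Finset ℝ} (L : Finset (ℝ × ℝ)) {ρ : ℝ} (h1 : 1 ≤ ρ)
    (hS : ρ ≤ #S) (hT : ρ ≤ #T) :
    (#{q ∈ L ×ˢ S | q.1.1 * q.2 + q.1.2 ∈ T} : ℝ) ≤
      2 * ρ * #L + 64 * (#S * #T) ^ 2 / ρ ^ 2 := by
  obtain ⟨r, hr⟩ : ∃ r : ℕ, r = ⌊ρ⌋₊ := ⟨_, rfl⟩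
  have hr1 : 1 ≤ r := hr ▸ Nat.one_le_floor_iff _ |>.2 h1
  have hr1' : (1 : ℝ) ≤ r := by exact_mod_cast hr1
  have hrρ : (r : ℝ) ≤ ρ := hr ▸ Nat.floor_le (by linarith)
  have hρr : ρ ≤ 2 * r := by
    have : ρ < r + 1 := hr ▸ Nat.lt_floor_add_one ρ
    linarith
  have key : ∀ U : Finset ℝ, ρ ≤ #U → ∃ s : ℕ, #U ≤ r * s ∧ (s : ℝ) * r ≤ 2 * #U := by
    intro U hU
    refine ⟨#U / r + 1, ?_, ?_⟩
    · have := Nat.lt_mul_div_succ (#U) (show 0 < r by omega)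
      exact this.le
    · have h : (#U / r) * r ≤ #U := Nat.div_mul_le_self _ _
      have h' : (((#U / r : ℕ) : ℝ)) * r ≤ #U := by exact_mod_cast h
      push_cast
      linarith
  obtain ⟨s, hs, hs'⟩ := key S hS
  obtain ⟨t, ht, ht'⟩ := key T hT
  have := incidences_le_of_cells L hs ht
  have h : (#{q ∈ L ×ˢ S | q.1.1 * q.2 + q.1.2 ∈ T} : ℝ) ≤
      2 * r * #L + r ^ 2 * (s * t) ^ 2 := by exact_mod_cast this
  refine h.trans (add_le_add (by gcongr) ?_)
  rw [le_div_iff₀ (by positivity)]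
  calc (r : ℝ) ^ 2 * (s * t) ^ 2 * ρ ^ 2 ≤ r ^ 2 * (s * t) ^ 2 * (2 * r) ^ 2 := by gcongr
    _ = 4 * (((s : ℝ) * r) * ((t : ℝ) * r)) ^ 2 := by ring
    _ ≤ 4 * ((2 * (#S : ℝ)) * (2 * (#T : ℝ))) ^ 2 := by gcongr
    _ = 64 * ((#S : ℝ) * #T) ^ 2 := by ring

/-- Plünnecke's inequality for a large subset. -/
lemma exists_subset_card_add_add_le {G : Type*} [AddCommGroup G] [DecidableEq G]
    {A B : Finset G} {K δ : ℝ} (hδ : 0 < δ) (hK : (#(A + B) : ℝ) ≤ K * #A) :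
    ∃ A' ⊆ A, (#(A \ A') : ℝ) ≤ δ * #A ∧ (#(A' + B + B) : ℝ) ≤ (K / δ) ^ 2 * #A := by
  suffices h : ∀ R ⊆ A, ∃ A' ⊆ R, (#(R \ A') : ℝ) ≤ δ * #A ∧
      (#(A' + B + B) : ℝ) ≤ (K / δ) ^ 2 * #A' by
    obtain ⟨A', h1, h2, h3⟩ := h A subset_rfl
    exact ⟨A', h1, h2, h3.trans (by gcongr)⟩
  intro R
  induction R using Finset.strongInduction with
  | H R ih =>
  intro hR
  by_cases hs : (#R : ℝ) ≤ δ * #A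
  · exact ⟨∅, empty_subset _, by simpa using hs, by simp⟩
  push Not at hs
  have hR0 : (0 : ℝ) < #R := lt_of_le_of_lt (by positivity) hs
  have hRne : R.Nonempty := card_pos.1 (by exact_mod_cast hR0)
  obtain ⟨X, hX, hmin⟩ := exists_min_image {X ∈ R.powerset | X.Nonempty}
    (fun X => (#(X + B) : ℝ) / #X) ⟨R, by simp [hRne]⟩
  simp only [mem_filter, mem_powerset] at hX hmin
  obtain ⟨hXR, hXne⟩ := hX
  have hX0 : (0 : ℝ) < #X := by exact_mod_cast hXne.card_pos
  have hpet : #(B + X + B) * #X ≤ #(X + B) * #(B + X) := by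
    apply pluennecke_petridis_inequality_add
    intro Y hY
    rcases Y.eq_empty_or_nonempty with rfl | hYne
    · simp
    have hY0 : (0 : ℝ) < #Y := by exact_mod_cast hYne.card_pos
    have := hmin Y ⟨hY.trans hXR, hYne⟩
    rw [div_le_div_iff₀ hX0 hY0] at this
    exact_mod_cast this
  have hratio : (#(X + B) : ℝ) / #X ≤ K / δ := by
    refine (hmin R ⟨subset_rfl, hRne⟩).trans ?_
    rw [div_le_div_iff₀ hR0 hδ]
    have h1 : (#(R + B) : ℝ) ≤ #(A + B) := by exact_mod_cast card_le_card (add_subset_add_right hR)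
    have hA0 : (0 : ℝ) < #A := lt_of_lt_of_le hR0 (by exact_mod_cast card_le_card hR)
    have hK0 : 0 ≤ K := by
      by_contra hneg
      push Not at hneg
      have := mul_neg_of_neg_of_pos hneg hA0
      have : (0 : ℝ) ≤ #(A + B) := by positivity
      linarith
    calc (#(R + B) : ℝ) * δ ≤ K * #A * δ := by gcongr; exact h1.trans hK
      _ = K * (δ * #A) := by ring
      _ ≤ K * #R := by gcongr
  have hXBB : (#(X + B + B) : ℝ) ≤ (K / δ) ^ 2 * #X := by
    have h1 : #(X + B + B) * #X ≤ #(X + B) * #(X + B) := by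
      rwa [add_comm B X] at hpet
    have h2 : (#(X + B + B) : ℝ) * #X ≤ #(X + B) * #(X + B) := by exact_mod_cast h1
    have h3 : (#(X + B) : ℝ) ≤ K / δ * #X := (div_le_iff₀ hX0).1 hratio
    refine le_of_mul_le_mul_right (h2.trans ?_) hX0
    calc (#(X + B) : ℝ) * #(X + B) ≤ (K / δ * #X) * (K / δ * #X) :=
          mul_self_le_mul_self (by positivity) h3
      _ = _ := by ring
  obtain ⟨Y, hY, hY1, hY2⟩ := ih (R \ X) (sdiff_ssubset hXR hXne) (sdiff_subset.trans hR)
  refine ⟨X ∪ Y, union_subset hXR (hY.trans sdiff_subset), ?_, ?_⟩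
  · rwa [← sup_eq_union, ← sdiff_sdiff_left]
  · have hd : Disjoint X Y := disjoint_of_subset_right hY disjoint_sdiff
    rw [card_union_of_disjoint hd, union_add, union_add]
    calc (#(X + B + B ∪ (Y + B + B)) : ℝ) ≤ #(X + B + B) + #(Y + B + B) := by
          exact_mod_cast card_union_le _ _
      _ ≤ (K / δ) ^ 2 * #X + (K / δ) ^ 2 * #Y := add_le_add hXBB hY2
      _ = _ := by push_cast; ring

lemma exists_subset_card_mul_mul_le {A B : Finset ℝ} (hA : ∀ a ∈ A, 0 < a) (hB : ∀ b ∈ B, 0 < b)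
    {K δ : ℝ} (hδ : 0 < δ) (hK : (#(A * B) : ℝ) ≤ K * #A) :
    ∃ A' ⊆ A, (#(A \ A') : ℝ) ≤ δ * #A ∧ (#(A' * B * B) : ℝ) ≤ (K / δ) ^ 2 * #A := by
  have himage : ∀ X Y : Finset ℝ, (∀ x ∈ X, 0 < x) → (∀ y ∈ Y, 0 < y) →
      (X * Y).image Real.log = X.image Real.log + Y.image Real.log := by
    intro X Y hX hY
    ext z
    simp only [mem_image, mem_mul, mem_add]
    constructor
    · rintro ⟨_, ⟨x, hx, y, hy, rfl⟩, rfl⟩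
      exact ⟨_, ⟨x, hx, rfl⟩, _, ⟨y, hy, rfl⟩, (Real.log_mul (hX x hx).ne' (hY y hy).ne').symm⟩
    · rintro ⟨_, ⟨x, hx, rfl⟩, _, ⟨y, hy, rfl⟩, rfl⟩
      exact ⟨_, ⟨x, hx, y, hy, rfl⟩, Real.log_mul (hX x hx).ne' (hY y hy).ne'⟩
  have hcard : ∀ X : Finset ℝ, (∀ x ∈ X, 0 < x) → #(X.image Real.log) = #X := fun X hX =>
    card_image_of_injOn fun x hx y hy h => Real.log_injOn_pos (hX x hx) (hX y hy) h
  have hmul : ∀ X Y : Finset ℝ, (∀ x ∈ X, 0 < x) → (∀ y ∈ Y, 0 < y) →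
      ∀ z ∈ X * Y, 0 < z := by
    intro X Y hX hY z hz
    obtain ⟨x, hx, y, hy, rfl⟩ := mem_mul.1 hz
    exact mul_pos (hX x hx) (hY y hy)
  obtain ⟨Y, hY, h1, h2⟩ := exists_subset_card_add_add_le (A := A.image Real.log)
    (B := B.image Real.log) hδ
    (by rwa [← himage A B hA hB, hcard _ (hmul A B hA hB), hcard A hA])
  obtain ⟨A', hA', rfl⟩ := subset_image_iff.1 hY
  have hA'' : A' ⊆ A := by exact_mod_cast hA'
  have hpos : ∀ a ∈ A', 0 < a := fun a ha => hA a (hA'' ha)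
  rw [hcard A hA] at h1 h2
  rw [← himage A' B hpos hB, ← himage _ B (hmul A' B hpos hB) hB,
    hcard _ (hmul _ _ (hmul A' B hpos hB) hB)] at h2
  refine ⟨A', hA'', ?_, h2⟩
  convert h1 using 2
  rw [card_sdiff_of_subset hA'', card_sdiff_of_subset hY, hcard A hA, hcard A' hpos]

lemma exists_card_translate_ge {A X : Finset ℝ} {K s s' : ℝ} (hK : 0 < K) (hA : A.Nonempty)
    (hX : X.Nonempty) (hs : s ≠ 0) (hs' : s' ≠ 0)
    (h : (#X * #A : ℝ) ≤ K * #{q ∈ A ×ˢ X | s * q.1 + s' * q.2 ∈ A}) :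
    ∃ x₀ ∈ X, ∃ c : ℝ, c ≠ 0 ∧
      (#X * #A : ℝ) ≤ K ^ 2 * #{q ∈ A ×ˢ X | q.1 + c * (q.2 - x₀) ∈ A} := by
  classical
  set D := {q ∈ A ×ˢ X | s * q.1 + s' * q.2 ∈ A} with hD
  set g : ℝ → Finset (ℝ × ℝ) := fun x₀ => {q ∈ A ×ˢ X | q.1 + s' / s * (q.2 - x₀) ∈ A} with hg
  have h1 := card_sq_le_card_mul_collisions D A (fun q => s * q.1 + s' * q.2)
    (fun q hq => (mem_filter.1 hq).2)
  have h2 : #{p ∈ D ×ˢ D | s * p.1.1 + s' * p.1.2 = s * p.2.1 + s' * p.2.2} ≤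
      ∑ x₀ ∈ X, #(g x₀) := by
    rw [← card_sigma]
    refine card_le_card_of_injOn (fun p => ⟨p.2.2, p.1⟩) ?_ ?_
    · rintro ⟨⟨a, x⟩, a', x'⟩ hp
      simp only [hD, hg, mem_coe, mem_filter, mem_product, mem_sigma] at hp ⊢
      obtain ⟨⟨⟨⟨ha, hx⟩, -⟩, ⟨ha', hx'⟩, -⟩, e⟩ := hp
      refine ⟨hx', ⟨ha, hx⟩, ?_⟩
      convert ha' using 1
      field_simp
      linarith
    · rintro ⟨⟨a, x⟩, a', x'⟩ hp ⟨⟨b, y⟩, b', y'⟩ hq e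
      simp only [mem_coe, mem_filter] at hp hq
      simp only [Sigma.mk.injEq, heq_eq_eq, Prod.mk.injEq] at e
      obtain ⟨rfl, rfl, rfl⟩ := e
      have : a' = b' := mul_left_cancel₀ hs (by linarith [hp.2, hq.2])
      rw [this]
  obtain ⟨x₀, hx₀, hmax⟩ := exists_max_image X (fun x => #(g x)) hX
  refine ⟨x₀, hx₀, s' / s, div_ne_zero hs' hs, ?_⟩
  have h3 : ∑ x ∈ X, #(g x) ≤ #X * #(g x₀) := by
    simpa using sum_le_card_nsmul X _ _ hmax
  have h4 : (#D : ℝ) ^ 2 ≤ #A * (#X * #(g x₀)) := by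
    exact_mod_cast h1.trans (Nat.mul_le_mul_left _ (h2.trans h3))
  have hA0 : (0 : ℝ) < #A := by exact_mod_cast hA.card_pos
  have hX0 : (0 : ℝ) < #X := by exact_mod_cast hX.card_pos
  refine le_of_mul_le_mul_right ?_ (mul_pos hX0 hA0)
  calc (#X * #A : ℝ) * (#X * #A) ≤ (K * #D) * (K * #D) := by gcongr
    _ = K ^ 2 * #D ^ 2 := by ring
    _ ≤ K ^ 2 * (#A * (#X * #(g x₀))) := by gcongr
    _ = K ^ 2 * #(g x₀) * (#X * #A) := by ring

lemma exists_popular_subset {A X : Finset ℝ} {K c x₀ : ℝ} (hK : 0 < K)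
    (hA : ∀ a ∈ A, 0 < a) (hX : ∀ x ∈ X, 0 < x) (hXK : 16 * K ^ 2 ≤ #X) (hA' : A.Nonempty)
    (hAX : (#(A * X) : ℝ) ≤ K * #A)
    (h : (#X * #A : ℝ) ≤ K ^ 2 * #{q ∈ A ×ˢ X | q.1 + c * (q.2 - x₀) ∈ A}) :
    ∃ B ⊆ A, ∃ Y ⊆ X, x₀ ∉ Y ∧ (#X : ℝ) ≤ 4 * K ^ 2 * #Y ∧
      (#(B * X * X) : ℝ) ≤ 16 * K ^ 6 * #A ∧
      ∀ x ∈ Y, (#A : ℝ) ≤ 8 * K ^ 2 * #{b ∈ B | b + c * (x - x₀) ∈ B} := by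
  classical
  obtain ⟨B, hBA, hB1, hB2⟩ := exists_subset_card_mul_mul_le hA hX
    (δ := 1 / (4 * K ^ 2)) (by positivity) hAX
  have hA0 : (0 : ℝ) < #A := by exact_mod_cast hA'.card_pos
  set r : ℝ → ℕ := fun x => #{b ∈ B | b + c * (x - x₀) ∈ B} with hr
  refine ⟨B, hBA, {x ∈ X | x ≠ x₀ ∧ (#A : ℝ) ≤ 8 * K ^ 2 * r x}, filter_subset _ _, by simp, ?_,
    hB2.trans (le_of_eq ?_), fun x hx => (mem_filter.1 hx).2.2⟩
  swap
  · field_simp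
    ring
  set Y := {x ∈ X | x ≠ x₀ ∧ (#A : ℝ) ≤ 8 * K ^ 2 * r x} with hY
  have hsplit : #{q ∈ A ×ˢ X | q.1 + c * (q.2 - x₀) ∈ A} ≤
      ∑ x ∈ X, r x + 2 * (#(A \ B) * #X) := by
    have hsub : {q ∈ A ×ˢ X | q.1 + c * (q.2 - x₀) ∈ A} ⊆
        {q ∈ B ×ˢ X | q.1 + c * (q.2 - x₀) ∈ B} ∪ (((A \ B) ×ˢ X) ∪
          {q ∈ A ×ˢ X | q.1 + c * (q.2 - x₀) ∈ A \ B}) := by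
      rintro ⟨a, x⟩ hq
      simp only [mem_filter, mem_product, mem_union, mem_sdiff] at hq ⊢
      tauto
    have e1 : #{q ∈ B ×ˢ X | q.1 + c * (q.2 - x₀) ∈ B} = ∑ x ∈ X, r x := by
      rw [← card_sigma]
      refine card_nbij' (fun q => ⟨q.2, q.1⟩) (fun q => (q.2, q.1)) ?_ ?_ ?_ ?_ <;>
        simp +contextual [Set.MapsTo, Set.LeftInvOn, Set.RightInvOn]
    have e2 : #{q ∈ A ×ˢ X | q.1 + c * (q.2 - x₀) ∈ A \ B} ≤ #((A \ B) ×ˢ X) := by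
      refine card_le_card_of_injOn (fun q => (q.1 + c * (q.2 - x₀), q.2)) ?_ ?_
      · rintro ⟨a, x⟩ hq
        simp only [mem_coe, mem_filter, mem_product] at hq ⊢
        exact ⟨hq.2, hq.1.2⟩
      · rintro ⟨a, x⟩ - ⟨b, y⟩ - e
        simp only [Prod.mk.injEq] at e
        obtain ⟨e, rfl⟩ := e
        simpa using e
    have := (card_le_card hsub).trans (card_union_le _ _)
    have h2 := card_union_le ((A \ B) ×ˢ X) {q ∈ A ×ˢ X | q.1 + c * (q.2 - x₀) ∈ A \ B}
    rw [card_product] at e2 h2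
    omega
  have hsum : (∑ x ∈ X, (r x : ℝ)) ≤ #Y * #A + #A + #X * (#A / (8 * K ^ 2)) := by
    have hpt : ∀ x ∈ X, (r x : ℝ) ≤
        (if x ∈ Y then (#A : ℝ) else 0) + (if x = x₀ then (#A : ℝ) else 0) + #A / (8 * K ^ 2) := by
      intro x hx
      have hrA : (r x : ℝ) ≤ #A := by
        exact_mod_cast card_le_card ((filter_subset _ _).trans hBA)
      have h0 : (0 : ℝ) ≤ #A / (8 * K ^ 2) := by positivity
      by_cases h1 : x = x₀
      · rw [if_pos h1]
        have : (0 : ℝ) ≤ if x ∈ Y then (#A : ℝ) else 0 := by positivity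
        linarith
      by_cases h2 : x ∈ Y
      · rw [if_pos h2, if_neg h1]
        linarith
      · rw [if_neg h1, if_neg h2]
        have : ¬ (#A : ℝ) ≤ 8 * K ^ 2 * r x := fun h3 => h2 (mem_filter.2 ⟨hx, h1, h3⟩)
        push Not at this
        rw [zero_add, zero_add, le_div_iff₀ (by positivity)]
        linarith
    refine (sum_le_sum hpt).trans ?_
    rw [sum_add_distrib, sum_add_distrib, sum_const, nsmul_eq_mul, ← sum_filter, ← sum_filter,
      sum_const, sum_const, nsmul_eq_mul, nsmul_eq_mul]
    have e1 : {x ∈ X | x ∈ Y} = Y := by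
      ext x
      simp only [hY, mem_filter]
      tauto
    have e2 : (#{x ∈ X | x = x₀} : ℝ) ≤ 1 := by
      exact_mod_cast card_le_one.2 (by simp +contextual)
    rw [e1]
    have := mul_le_mul_of_nonneg_right e2 hA0.le
    linarith
  have hsplit' : (#{q ∈ A ×ˢ X | q.1 + c * (q.2 - x₀) ∈ A} : ℝ) ≤
      ∑ x ∈ X, (r x : ℝ) + 2 * (#(A \ B) * #X) := by exact_mod_cast hsplit
  have h5 : (#X * #A : ℝ) ≤ K ^ 2 * (#Y * #A + #A + #X * (#A / (8 * K ^ 2)) +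
      2 * (1 / (4 * K ^ 2) * #A * #X)) := by
    refine h.trans ?_
    gcongr
    refine hsplit'.trans ?_
    gcongr
  have h6 : K ^ 2 * (#Y * #A + #A + #X * (#A / (8 * K ^ 2)) + 2 * (1 / (4 * K ^ 2) * #A * #X)) =
      (K ^ 2 * #Y + K ^ 2 + 5 / 8 * #X : ℝ) * #A := by
    field_simp
    ring
  rw [h6] at h5
  have := le_of_mul_le_mul_right h5 hA0
  linarith

lemma card_differences_mul_le {X E V : Finset ℝ} {K N : ℝ} (hK : 16 ≤ K) (hN : 0 < N)
    (hX : ∀ x ∈ X, 0 < x) (hXN : #X ≤ N) (hE : #E ≤ K * N) (hEX : #(E * X) ≤ 16 * K ^ 6 * N)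
    (hV : ∀ v ∈ V, N ≤ 8 * K ^ 2 * #{q ∈ E ×ˢ E | q.1 - q.2 = v}) :
    (#V * #X : ℝ) ≤ K ^ 27 * N := by
  classical
  have hK0 : 0 < K := by linarith
  have hreps : (#V * N : ℝ) ≤ 8 * K ^ 2 * #{q ∈ E ×ˢ E | q.1 - q.2 ∈ V} := by
    have e : #{q ∈ E ×ˢ E | q.1 - q.2 ∈ V} = ∑ v ∈ V, #{q ∈ E ×ˢ E | q.1 - q.2 = v} := by
      rw [card_eq_sum_card_fiberwise (f := fun q : ℝ × ℝ => q.1 - q.2) (t := V)]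
      · refine sum_congr rfl fun v hv => ?_
        rw [filter_filter]
        congr 1
        ext q
        simp only [mem_filter]
        constructor
        · rintro ⟨h1, -, h2⟩
          exact ⟨h1, h2⟩
        · rintro ⟨h1, h2⟩
          exact ⟨h1, h2 ▸ hv, h2⟩
      · intro q hq
        exact (mem_filter.1 hq).2
    rw [e]
    push_cast
    rw [mul_sum]
    calc (#V * N : ℝ) = ∑ v ∈ V, N := by simp
      _ ≤ _ := sum_le_sum hV
  set L : Finset (ℝ × ℝ) := (E * X) ×ˢ E.image (fun e => -e) with hL
  have hLcard : (#L : ℝ) ≤ 16 * K ^ 7 * N ^ 2 := by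
    rw [hL, card_product]
    have : (#(E.image (fun e => -e)) : ℝ) ≤ K * N :=
      le_trans (by exact_mod_cast card_image_le) hE
    push_cast
    calc (#(E * X) : ℝ) * #(E.image (fun e => -e)) ≤ (16 * K ^ 6 * N) * (K * N) := by gcongr
      _ = _ := by ring
  set S := X.image (fun x => x⁻¹) with hS
  have hScard : #S = #X := card_image_of_injective _ inv_injective
  have hinc : #{q ∈ E ×ˢ E | q.1 - q.2 ∈ V} * #X ≤
      #{q ∈ L ×ˢ S | q.1.1 * q.2 + q.1.2 ∈ V} := by
    rw [← card_product]
    refine card_le_card_of_injOn (fun p => ((p.1.1 * p.2, -p.1.2), p.2⁻¹)) ?_ ?_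
    · rintro ⟨⟨e, e'⟩, h⟩ hp
      simp only [mem_coe, mem_filter, mem_product, hL, hS] at hp ⊢
      obtain ⟨⟨⟨he, he'⟩, hv⟩, hh⟩ := hp
      refine ⟨⟨⟨mul_mem_mul he hh, mem_image_of_mem _ he'⟩, mem_image_of_mem _ hh⟩, ?_⟩
      rwa [mul_inv_cancel_right₀ (hX h hh).ne', ← sub_eq_add_neg]
    · rintro ⟨⟨e, e'⟩, h⟩ hp ⟨⟨f, f'⟩, h'⟩ hq eq
      simp only [mem_coe, mem_product] at hp
      simp only [Prod.mk.injEq, neg_inj, inv_inj] at eq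
      obtain ⟨⟨e1, rfl⟩, rfl⟩ := eq
      rw [mul_right_cancel₀ (hX h hp.2).ne' e1]
  have hI : (#V * #X * N : ℝ) ≤ 8 * K ^ 2 * #{q ∈ L ×ˢ S | q.1.1 * q.2 + q.1.2 ∈ V} := by
    calc (#V * #X * N : ℝ) = #V * N * #X := by ring
      _ ≤ 8 * K ^ 2 * #{q ∈ E ×ˢ E | q.1 - q.2 ∈ V} * #X := by gcongr
      _ = 8 * K ^ 2 * (#{q ∈ E ×ˢ E | q.1 - q.2 ∈ V} * #X : ℕ) := by push_cast; ring
      _ ≤ _ := by gcongr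
  have hVcard : (#V : ℝ) ≤ 8 * K ^ 4 * N := by
    have : (#{q ∈ E ×ˢ E | q.1 - q.2 ∈ V} : ℝ) ≤ #E * #E := by
      exact_mod_cast (card_filter_le _ _).trans (card_product _ _).le
    refine le_of_mul_le_mul_right (hreps.trans ?_) hN
    calc 8 * K ^ 2 * (#{q ∈ E ×ˢ E | q.1 - q.2 ∈ V} : ℝ)
        ≤ 8 * K ^ 2 * ((K * N) * (K * N)) := by
          gcongr
          exact this.trans (by gcongr)
      _ = _ := by ring
  have hpow : (2 : ℝ) ^ 28 ≤ K ^ 7 := by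
    calc (2 : ℝ) ^ 28 = 16 ^ 7 := by norm_num
      _ ≤ K ^ 7 := by gcongr
  obtain ⟨ρ, hρ⟩ : ∃ ρ : ℝ, ρ = #V * #X / (512 * K ^ 9 * N) := ⟨_, rfl⟩
  rcases lt_or_ge ρ 1 with h1 | h1
  · rw [hρ, div_lt_one (by positivity)] at h1
    refine h1.le.trans ?_
    gcongr
    calc 512 * K ^ 9 ≤ K ^ 7 * K ^ 9 := by gcongr; linarith
      _ ≤ K ^ 7 * K ^ 20 := by gcongr <;> linarith
      _ = K ^ 27 := by ring
  · have hK9 : 8 * K ^ 4 ≤ 512 * K ^ 9 := by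
      have : K ^ 4 ≤ K ^ 9 := by gcongr <;> linarith
      have : 0 ≤ K ^ 4 := by positivity
      linarith
    have hρS : ρ ≤ #S := by
      rw [hρ, hScard, div_le_iff₀ (by positivity), mul_comm (#X : ℝ)]
      gcongr
      exact hVcard.trans (by gcongr)
    have hρV : ρ ≤ #V := by
      rw [hρ, div_le_iff₀ (by positivity)]
      gcongr
      refine hXN.trans ?_
      have : 1 ≤ 512 * K ^ 9 := by
        have : 1 ≤ K ^ 9 := one_le_pow₀ (by linarith)
        linarith
      nlinarith
    have hinc := incidences_le L h1 hρS hρV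
    rw [hScard] at hinc
    have hρ0 : 0 < ρ := by linarith
    have hVX : (#V * #X : ℝ) = ρ * (512 * K ^ 9 * N) := by
      rw [hρ]
      field_simp
    have e2 : 64 * (#X * #V : ℝ) ^ 2 / ρ ^ 2 = 2 ^ 24 * K ^ 18 * N ^ 2 := by
      rw [mul_comm (#X : ℝ), hVX]
      field_simp
      norm_num
    rw [e2] at hinc
    have h3 : (#V * #X * N : ℝ) ≤ 8 * K ^ 2 * (2 * ρ * (16 * K ^ 7 * N ^ 2) +
        2 ^ 24 * K ^ 18 * N ^ 2) := by
      refine hI.trans ?_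
      gcongr
      exact hinc.trans (by gcongr)
    have h4 : 8 * K ^ 2 * (2 * ρ * (16 * K ^ 7 * N ^ 2) + 2 ^ 24 * K ^ 18 * N ^ 2) =
        (1 / 2 * (#V * #X) + 2 ^ 27 * K ^ 20 * N) * N := by
      rw [hVX]
      ring
    rw [h4] at h3
    have h5 := le_of_mul_le_mul_right h3 hN
    calc (#V * #X : ℝ) ≤ 2 ^ 28 * (K ^ 20 * N) := by linarith
      _ ≤ K ^ 7 * (K ^ 20 * N) := by gcongr
      _ = _ := by ring

lemma card_div_mul_le {X Y : Finset ℝ} {c x₀ : ℝ} (hc : c ≠ 0) (hX : ∀ x ∈ X, 0 < x)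
    (hx₀ : x₀ ∉ Y) :
    #(X / X) * #Y ≤ #((Y ×ˢ X).image fun p => c * (p.1 - x₀) * p.2) ^ 2 := by
  classical
  have hch : ∀ w : ℝ, ∃ p : ℝ × ℝ, w ∈ X / X → p.1 ∈ X ∧ p.2 ∈ X ∧ p.1 / p.2 = w := by
    intro w
    by_cases hw : w ∈ X / X
    · obtain ⟨a, ha, b, hb, e⟩ := mem_div.1 hw
      exact ⟨(a, b), fun _ => ⟨ha, hb, e⟩⟩
    · exact ⟨0, fun h => absurd h hw⟩
  choose p hp using hch
  set V := (Y ×ˢ X).image fun p => c * (p.1 - x₀) * p.2 with hV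
  rw [sq, ← card_product, ← card_product]
  refine card_le_card_of_injOn
    (fun q => (c * (q.2 - x₀) * (p q.1).1, c * (q.2 - x₀) * (p q.1).2)) ?_ ?_
  · rintro ⟨w, x⟩ hq
    simp only [mem_coe, mem_product] at hq ⊢
    obtain ⟨h1, h2, -⟩ := hp w hq.1
    exact ⟨mem_image.2 ⟨(x, _), mem_product.2 ⟨hq.2, h1⟩, rfl⟩,
      mem_image.2 ⟨(x, _), mem_product.2 ⟨hq.2, h2⟩, rfl⟩⟩
  · rintro ⟨w, x⟩ hq ⟨w', x'⟩ hq' e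
    simp only [mem_coe, mem_product] at hq hq'
    simp only [Prod.mk.injEq] at e
    obtain ⟨e1, e2⟩ := e
    obtain ⟨-, h2, h3⟩ := hp w hq.1
    obtain ⟨-, h2', h3'⟩ := hp w' hq'.1
    have hne : ∀ y ∈ Y, c * (y - x₀) ≠ 0 := fun y hy =>
      mul_ne_zero hc (sub_ne_zero.2 fun h => hx₀ (h ▸ hy))
    have hw : w = w' := by
      rw [← h3, ← h3', ← mul_div_mul_left _ _ (hne x hq.2), e1, e2,
        mul_div_mul_left _ _ (hne x' hq'.2)]
    subst hw
    have := mul_left_cancel₀ hc (mul_right_cancel₀ (hX _ h2).ne' e2)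
    have hx : x = x' := by linarith
    rw [hx]

lemma pow_five_le_of_incidences {X Y : Finset ℝ} {K c x₀ : ℝ} (hK : 16 ≤ K) (hc : c ≠ 0)
    (hX : ∀ x ∈ X, 0 < x) (hx₀X : x₀ ∈ X) (hYX : Y ⊆ X) (hx₀ : x₀ ∉ Y)
    (hXK : 16 * K ^ 2 ≤ #X) (hY : (#X : ℝ) ≤ 4 * K ^ 2 * #Y) :
    (#X : ℝ) ^ 5 ≤ 2 ^ 17 * K ^ 6 *
      (#((Y ×ˢ X).image fun p => c * (p.1 - x₀) * p.2) * #(X / X)) ^ 2 := by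
  classical
  have hK0 : 0 < K := by linarith
  have hX0 : (0 : ℝ) < #X := lt_of_lt_of_le (by positivity) hXK
  have hY0 : (0 : ℝ) < #Y := by
    by_contra h
    have : 4 * K ^ 2 * (#Y : ℝ) ≤ 0 := mul_nonpos_of_nonneg_of_nonpos (by positivity) (by linarith)
    linarith
  obtain ⟨y₀, hy₀⟩ : Y.Nonempty := card_pos.1 (by exact_mod_cast hY0)
  have hne : ∀ y ∈ Y, c * (y - x₀) ≠ 0 := fun y hy =>
    mul_ne_zero hc (sub_ne_zero.2 fun h => hx₀ (h ▸ hy))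
  set V := (Y ×ˢ X).image fun p => c * (p.1 - x₀) * p.2 with hV
  have hVX : #X ≤ #V := by
    refine card_le_card_of_injOn (fun x => c * (y₀ - x₀) * x) ?_ ?_
    · intro x hx
      exact mem_image.2 ⟨(y₀, x), mem_product.2 ⟨hy₀, hx⟩, rfl⟩
    · intro x _ x' _ e
      exact mul_left_cancel₀ (hne y₀ hy₀) e
  have hWX : #X ≤ #(X / X) := by
    refine card_le_card_of_injOn (fun x => x / x₀) ?_ ?_
    · intro x hx
      exact div_mem_div hx hx₀X
    · intro x _ x' _ e
      exact (div_left_inj' (hX x₀ hx₀X).ne').1 e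
  set L : Finset (ℝ × ℝ) := (X ×ˢ X).image (fun q => (1 / (q.2 * (c * q.1)), x₀ / q.2)) with hL
  have hLcard : (#L : ℝ) ≤ #X * #X := by
    exact_mod_cast card_image_le.trans (card_product _ _).le
  have hinc : #X * #X * #Y ≤ #{q ∈ L ×ˢ V | q.1.1 * q.2 + q.1.2 ∈ X / X} := by
    rw [← card_product, ← card_product]
    refine card_le_card_of_injOn (fun p =>
      ((1 / (p.1.2 * (c * p.1.1)), x₀ / p.1.2), c * (p.2 - x₀) * p.1.1)) ?_ ?_
    · rintro ⟨⟨y, z⟩, x⟩ hp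
      simp only [mem_coe, mem_filter, mem_product] at hp ⊢
      obtain ⟨⟨hy, hz⟩, hx⟩ := hp
      refine ⟨⟨mem_image.2 ⟨(y, z), mem_product.2 ⟨hy, hz⟩, rfl⟩,
        mem_image.2 ⟨(x, y), mem_product.2 ⟨hx, hy⟩, rfl⟩⟩, ?_⟩
      have hz0 := (hX z hz).ne'
      have hy0 := (hX y hy).ne'
      have : 1 / (z * (c * y)) * (c * (x - x₀) * y) + x₀ / z = x / z := by
        field_simp
        ring
      rw [this]
      exact div_mem_div (hYX hx) hz
    · rintro ⟨⟨y, z⟩, x⟩ hp ⟨⟨y', z'⟩, x'⟩ hp' e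
      simp only [mem_coe, mem_product] at hp hp'
      simp only [Prod.mk.injEq] at e
      obtain ⟨⟨e1, e2⟩, e3⟩ := e
      have hz : z = z' := by
        have := (hX x₀ hx₀X).ne'
        have h1 := (hX z hp.1.2).ne'
        have h2 := (hX z' hp'.1.2).ne'
        field_simp at e2
        exact e2.symm
      subst hz
      have hz0 := (hX z hp.1.2).ne'
      have hy : y = y' := by
        rw [one_div, one_div, inv_inj] at e1
        exact mul_left_cancel₀ hc (mul_left_cancel₀ hz0 e1)
      subst hy
      have := mul_left_cancel₀ hc (mul_right_cancel₀ (hX y hp.1.1).ne' e3)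
      have hx : x = x' := by linarith
      rw [hx]
  obtain ⟨ρ, hρ⟩ : ∃ ρ : ℝ, ρ = #X / (16 * K ^ 2) := ⟨_, rfl⟩
  have hρ1 : 1 ≤ ρ := by rwa [hρ, one_le_div (by positivity)]
  have hρX : ρ ≤ #X := by
    rw [hρ]
    apply div_le_self hX0.le
    nlinarith
  have hVX' : (#X : ℝ) ≤ #V := by exact_mod_cast hVX
  have hWX' : (#X : ℝ) ≤ #(X / X) := by exact_mod_cast hWX
  have hst := incidences_le L hρ1 (hρX.trans hVX') (hρX.trans hWX')
  have hinc' : (#X * #X * #Y : ℝ) ≤ #{q ∈ L ×ˢ V | q.1.1 * q.2 + q.1.2 ∈ X / X} := by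
    exact_mod_cast hinc
  have hXρ : (#X : ℝ) = 16 * K ^ 2 * ρ := by
    rw [hρ]
    field_simp
  clear hρ
  have h1 : (#X : ℝ) ^ 3 ≤ 4 * K ^ 2 * (2 * ρ * (#X * #X) + 64 * (#V * #(X / X)) ^ 2 / ρ ^ 2) := by
    calc (#X : ℝ) ^ 3 = #X * #X * #X := by ring
      _ ≤ #X * #X * (4 * K ^ 2 * #Y) := by gcongr
      _ = 4 * K ^ 2 * (#X * #X * #Y) := by ring
      _ ≤ _ := by
        gcongr
        refine (hinc'.trans hst).trans ?_
        gcongr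
  have h2 : 4 * K ^ 2 * (2 * ρ * (#X * #X : ℝ)) = (#X : ℝ) ^ 3 / 2 := by
    rw [hXρ]
    ring
  have h3 : (#X : ℝ) ^ 3 ≤ 8 * K ^ 2 * (64 * (#V * #(X / X)) ^ 2 / ρ ^ 2) := by linarith
  have hρ0 : 0 < ρ := by linarith
  calc (#X : ℝ) ^ 5 = #X ^ 3 * #X ^ 2 := by ring
    _ ≤ 8 * K ^ 2 * (64 * (#V * #(X / X)) ^ 2 / ρ ^ 2) * #X ^ 2 := by gcongr
    _ = _ := by
      rw [hXρ]
      field_simp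
      ring

/-- If `A * X` is small, then linear forms `s * a + s' * x` take values in `A` only rarely. -/
lemma card_pow_le_of_card_linear_ge {A X : Finset ℝ} {K s s' : ℝ} (hK : 16 ≤ K)
    (hA : ∀ a ∈ A, 0 < a) (hX : ∀ x ∈ X, 0 < x) (hA0 : A.Nonempty) (hXA : #X ≤ #A)
    (hAX : (#(A * X) : ℝ) ≤ K * #A) (hs : s ≠ 0) (hs' : s' ≠ 0)
    (h : (#X * #A : ℝ) ≤ K * #{q ∈ A ×ˢ X | s * q.1 + s' * q.2 ∈ A}) :
    (#X : ℝ) ^ 13 ≤ #A ^ 6 * K ^ 180 := by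
  classical
  have hK0 : 0 < K := by linarith
  have hK1 : 1 ≤ K := by linarith
  have hAp : (0 : ℝ) < #A := by exact_mod_cast hA0.card_pos
  have hA1 : (1 : ℝ) ≤ #A := by exact_mod_cast hA0.card_pos
  rcases lt_or_ge (#X : ℝ) (16 * K ^ 2) with hsm | hXK
  · calc (#X : ℝ) ^ 13 ≤ (K * K ^ 2) ^ 13 := by
          gcongr
          exact hsm.le.trans (by gcongr)
      _ = 1 ^ 6 * K ^ 39 := by ring
      _ ≤ _ := by gcongr; linarith
  have hXp : (0 : ℝ) < #X := lt_of_lt_of_le (by positivity) hXK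
  have hX0 : X.Nonempty := card_pos.1 (by exact_mod_cast hXp)
  obtain ⟨x₀, hx₀, c, hc, h1⟩ := exists_card_translate_ge hK0 hA0 hX0 hs hs' h
  obtain ⟨B, hBA, Y, hYX, hx₀Y, hY, hBXX, hpop⟩ :=
    exists_popular_subset hK0 hA hX hXK hA0 hAX h1
  have h5 := pow_five_le_of_incidences hK hc hX hx₀ hYX hx₀Y hXK hY
  have hW := card_div_mul_le (X := X) (Y := Y) hc hX hx₀Y
  set V := (Y ×ˢ X).image fun p => c * (p.1 - x₀) * p.2 with hV
  have hVX : (#V * #X : ℝ) ≤ K ^ 27 * #A := by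
    refine card_differences_mul_le (E := B * X) hK hAp hX (by exact_mod_cast hXA) ?_ hBXX ?_
    · exact le_trans (by exact_mod_cast card_le_card (mul_subset_mul_right hBA)) hAX
    · intro v hv
      obtain ⟨⟨x, y⟩, hxy, rfl⟩ := mem_image.1 hv
      obtain ⟨hx, hy⟩ := mem_product.1 hxy
      refine (hpop x hx).trans ?_
      gcongr
      refine card_le_card_of_injOn (fun b => ((b + c * (x - x₀)) * y, b * y)) ?_ ?_
      · intro b hb
        simp only [mem_coe, mem_filter, mem_product] at hb ⊢
        exact ⟨⟨mul_mem_mul hb.2 hy, mul_mem_mul hb.1 hy⟩, by ring⟩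
      · intro b _ b' _ e
        exact mul_right_cancel₀ (hX y hy).ne' (Prod.mk.inj e).2
  have hW' : (#(X / X) * #X : ℝ) ≤ 4 * K ^ 2 * #V ^ 2 := by
    calc (#(X / X) * #X : ℝ) ≤ #(X / X) * (4 * K ^ 2 * #Y) := by gcongr
      _ = 4 * K ^ 2 * (#(X / X) * #Y : ℕ) := by push_cast; ring
      _ ≤ 4 * K ^ 2 * (#V ^ 2 : ℕ) := by gcongr
      _ = _ := by push_cast; ring
  have hVW : (#V * #(X / X) : ℝ) * #X ^ 4 ≤ 4 * K ^ 83 * #A ^ 3 := by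
    calc (#V * #(X / X) : ℝ) * #X ^ 4 = #V * (#(X / X) * #X) * #X ^ 3 := by ring
      _ ≤ #V * (4 * K ^ 2 * #V ^ 2) * #X ^ 3 := by gcongr
      _ = 4 * K ^ 2 * (#V * #X) ^ 3 := by ring
      _ ≤ 4 * K ^ 2 * (K ^ 27 * #A) ^ 3 := by gcongr
      _ = _ := by ring
  calc (#X : ℝ) ^ 13 = #X ^ 5 * (#X ^ 4) ^ 2 := by ring
    _ ≤ 2 ^ 17 * K ^ 6 * (#V * #(X / X)) ^ 2 * (#X ^ 4) ^ 2 := by gcongr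
    _ = 2 ^ 17 * K ^ 6 * ((#V * #(X / X)) * #X ^ 4) ^ 2 := by ring
    _ ≤ 2 ^ 17 * K ^ 6 * (4 * K ^ 83 * #A ^ 3) ^ 2 := by gcongr
    _ = #A ^ 6 * (2 ^ 21 * K ^ 172) := by ring
    _ ≤ #A ^ 6 * (16 ^ 6 * K ^ 172) := by
      gcongr
      norm_num
    _ ≤ #A ^ 6 * (K ^ 6 * K ^ 172) := by gcongr
    _ = #A ^ 6 * K ^ 178 := by ring
    _ ≤ #A ^ 6 * K ^ 180 := by gcongr; linarith

lemma exists_initial_segment (Λ : Finset ℝ) {M : ℕ} (hM : M ≤ #Λ) :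
    ∃ I ⊆ Λ, #I = M ∧ ∀ i ∈ I, ∀ j ∈ Λ \ I, i < j := by
  classical
  induction M with
  | zero => exact ⟨∅, by simp⟩
  | succ M ih =>
    obtain ⟨I, hI, hcard, hlt⟩ := ih (by omega)
    have hne : (Λ \ I).Nonempty := by
      rw [← card_pos, card_sdiff_of_subset hI]
      omega
    obtain ⟨m, hm, hmin⟩ := exists_min_image (Λ \ I) id hne
    rw [mem_sdiff] at hm
    refine ⟨insert m I, insert_subset hm.1 hI, by rw [card_insert_of_notMem hm.2, hcard], ?_⟩
    intro i hi j hj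
    simp only [mem_sdiff, mem_insert, not_or] at hj hi
    have hj' : j ∈ Λ \ I := mem_sdiff.2 ⟨hj.1, hj.2.2⟩
    rcases hi with rfl | hi
    · exact lt_of_le_of_ne (hmin j hj') (Ne.symm hj.2.1)
    · exact hlt i hi j hj'

/-- The points of `P` whose slope `σ` lies between two elements of `I`. -/
noncomputable def sector {α : Type*} (σ : α → ℝ) (P : Finset α) (I : Finset ℝ) : Finset α := by
  classical exact {p ∈ P | ∃ i ∈ I, ∃ j ∈ I, i ≤ σ p ∧ σ p ≤ j}

lemma mem_sector {α : Type*} {σ : α → ℝ} {P : Finset α} {I : Finset ℝ} {p : α} :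
    p ∈ sector σ P I ↔ p ∈ P ∧ ∃ i ∈ I, ∃ j ∈ I, i ≤ σ p ∧ σ p ≤ j := by
  simp [sector]

/-- If every cluster of `M` consecutive slopes carries many points, so does the whole plane. -/
lemma mul_sum_sub_le_card {α : Type*} (σ : α → ℝ) (n : ℝ → ℝ) {ν f : ℝ} {M : ℕ} (hM : 1 ≤ M)
    (hf : 0 ≤ f) (hν : 0 ≤ ν) (Λ : Finset ℝ) (hn : ∀ i ∈ Λ, n i ≤ ν) (P : Finset α)
    (h : ∀ I ⊆ Λ, #I = M → f * ∑ i ∈ I, n i ≤ #(sector σ P I)) :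
    f * (∑ i ∈ Λ, n i - M * ν) ≤ #P := by
  classical
  induction Λ using Finset.strongInduction generalizing P with
  | H Λ ih =>
  rcases lt_or_ge (#Λ) M with hlt | hge
  · have h1 : ∑ i ∈ Λ, n i ≤ M * ν := by
      calc ∑ i ∈ Λ, n i ≤ #Λ • ν := sum_le_card_nsmul _ _ _ hn
        _ = #Λ * ν := nsmul_eq_mul _ _
        _ ≤ M * ν := by gcongr
    have h2 : f * (∑ i ∈ Λ, n i - M * ν) ≤ 0 :=
      mul_nonpos_of_nonneg_of_nonpos hf (by linarith)
    exact h2.trans (by positivity)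
  · obtain ⟨I, hI, hcard, hlt⟩ := exists_initial_segment Λ hge
    have hIne : I.Nonempty := card_pos.1 (by omega)
    obtain ⟨m, hm, hmax⟩ := exists_max_image I id hIne
    have hP : #{p ∈ P | σ p ≤ m} + #{p ∈ P | ¬ σ p ≤ m} = #P :=
      card_filter_add_card_filter_not _
    have h1 : f * ∑ i ∈ I, n i ≤ #{p ∈ P | σ p ≤ m} := by
      refine (h I hI hcard).trans ?_
      norm_cast
      refine card_le_card fun p hp => ?_
      obtain ⟨hp, i, hi, j, hj, h1, h2⟩ := mem_sector.1 hp
      exact mem_filter.2 ⟨hp, h2.trans (hmax j hj)⟩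
    have h2 : f * (∑ i ∈ Λ \ I, n i - M * ν) ≤ #{p ∈ P | ¬ σ p ≤ m} := by
      refine ih (Λ \ I) (sdiff_ssubset hI hIne) (fun i hi => hn i (mem_sdiff.1 hi).1) _ ?_
      intro J hJ hJcard
      refine (h J (hJ.trans sdiff_subset) hJcard).trans ?_
      norm_cast
      refine card_le_card fun p hp => ?_
      obtain ⟨hp, i, hi, j, hj, h1, h2⟩ := mem_sector.1 hp
      have := hlt m hm i (hJ hi)
      exact mem_sector.2 ⟨mem_filter.2 ⟨hp, by linarith⟩, i, hi, j, hj, h1, h2⟩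
    have hsum := sum_sdiff (f := n) hI
    have hP' : (#{p ∈ P | σ p ≤ m} + #{p ∈ P | ¬ σ p ≤ m} : ℝ) = #P := by exact_mod_cast hP
    rw [← hP', ← hsum]
    linarith

/-- The elements `x` of `A` for which the point of slope `r` above `x` lies in `A × A`. -/
noncomputable def slice (A : Finset ℝ) (r : ℝ) : Finset ℝ := {x ∈ A | r * x ∈ A}

lemma mem_slice {A : Finset ℝ} {r x : ℝ} : x ∈ slice A r ↔ x ∈ A ∧ r * x ∈ A := by
  simp [slice]

noncomputable def slope (p : ℝ × ℝ) : ℝ := p.2 / p.1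

/-- The points of `A × A` with slope in `I`. -/
noncomputable def cone (A I : Finset ℝ) : Finset (ℝ × ℝ) := {q ∈ A ×ˢ A | slope q ∈ I}

lemma mem_cone {A I : Finset ℝ} {q : ℝ × ℝ} :
    q ∈ cone A I ↔ (q.1 ∈ A ∧ q.2 ∈ A) ∧ slope q ∈ I := by
  simp [cone]

lemma slope_mul_fst {q : ℝ × ℝ} (h : 0 < q.1) : slope q * q.1 = q.2 :=
  div_mul_cancel₀ _ h.ne'

lemma card_cone {A : Finset ℝ} (hA : ∀ a ∈ A, 0 < a) (I : Finset ℝ) :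
    #(cone A I) = ∑ i ∈ I, #(slice A i) := by
  rw [card_eq_sum_card_fiberwise (f := slope) (t := I) (fun q hq => (mem_cone.1 hq).2)]
  refine sum_congr rfl fun i hi => ?_
  refine card_nbij' (fun q => q.1) (fun x => (x, i * x)) ?_ ?_ ?_ ?_
  · intro q hq
    obtain ⟨h1, rfl⟩ := mem_filter.1 hq
    obtain ⟨⟨h1, h2⟩, -⟩ := mem_cone.1 h1
    rw [mem_coe, mem_slice, slope_mul_fst (hA _ h1)]
    exact ⟨h1, h2⟩
  · intro x hx
    obtain ⟨h1, h2⟩ := mem_slice.1 hx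
    have : slope (x, i * x) = i := mul_div_cancel_right₀ _ (hA x h1).ne'
    exact mem_filter.2 ⟨mem_cone.2 ⟨⟨h1, h2⟩, (congrArg (· ∈ I) this).mpr hi⟩, this⟩
  · intro q hq
    obtain ⟨h1, rfl⟩ := mem_filter.1 hq
    exact Prod.ext rfl (slope_mul_fst (hA _ (mem_cone.1 h1).1.1))
  · intro x _
    rfl

lemma mem_sector_of_add {P : Finset (ℝ × ℝ)} {I : Finset ℝ} {i j x y : ℝ} (hi : i ∈ I)
    (hj : j ∈ I) (hx : 0 < x) (hy : 0 < y) (hP : (x + y, i * x + j * y) ∈ P) :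
    (x + y, i * x + j * y) ∈ sector slope P I := by
  refine mem_sector.2 ⟨hP, ?_⟩
  have hxy : 0 < x + y := by linarith
  simp only [slope]
  rcases le_total i j with h | h
  · refine ⟨i, hi, j, hj, ?_, ?_⟩
    · rw [le_div_iff₀ hxy]
      linarith [mul_le_mul_of_nonneg_right h hy.le]
    · rw [div_le_iff₀ hxy]
      linarith [mul_le_mul_of_nonneg_right h hx.le]
  · refine ⟨j, hj, i, hi, ?_, ?_⟩
    · rw [le_div_iff₀ hxy]
      linarith [mul_le_mul_of_nonneg_right h hx.le]
    · rw [div_le_iff₀ hxy]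
      linarith [mul_le_mul_of_nonneg_right h hy.le]

lemma card_mul_slice_mul_le {A S : Finset ℝ} (hA : ∀ a ∈ A, 0 < a)
    (hS : ∀ a ∈ A, ∀ b ∈ A, ∀ c ∈ A, a * b + c ∈ S) {I : Finset ℝ} {i j : ℝ} (hi : i ∈ I)
    (hj : j ∈ I) (hij : i ≠ j) :
    #(A * slice A i) * #(slice A j) ≤ #(sector slope (S ×ˢ S) I) := by
  rw [← card_product]
  refine card_le_card_of_injOn (fun p => (p.1 + p.2, i * p.1 + j * p.2)) ?_ ?_
  · rintro ⟨z, y⟩ hp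
    obtain ⟨hz, hy⟩ := mem_product.1 hp
    obtain ⟨a, ha, x, hx, rfl⟩ := mem_mul.1 hz
    obtain ⟨hx, hx'⟩ := mem_slice.1 hx
    obtain ⟨hy, hy'⟩ := mem_slice.1 hy
    refine mem_sector_of_add hi hj (mul_pos (hA a ha) (hA x hx)) (hA y hy)
      (mem_product.2 ⟨hS a ha x hx y hy, ?_⟩)
    simpa [mul_left_comm] using hS a ha _ hx' _ hy'
  · rintro ⟨z, y⟩ - ⟨z', y'⟩ - e
    simp only [Prod.mk.injEq] at e
    obtain ⟨e1, e2⟩ := e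
    have : (i - j) * z = (i - j) * z' := by linear_combination e2 - j * e1
    have hz := mul_left_cancel₀ (sub_ne_zero.2 hij) this
    have hy : y = y' := by linarith
    rw [hz, hy]

/-- The sum of `a` times the point of slope `i` above `u i` and of a point `q`. -/
def shear (u : ℝ → ℝ) (d : (ℝ × ℝ) × (ℝ × ℝ)) : ℝ × ℝ :=
  (d.1.1 * u d.1.2 + d.2.1, d.1.2 * (d.1.1 * u d.1.2) + d.2.2)

lemma shear_mem_sector {A S I : Finset ℝ} (hA : ∀ a ∈ A, 0 < a)
    (hS : ∀ a ∈ A, ∀ b ∈ A, ∀ c ∈ A, a * b + c ∈ S) {u : ℝ → ℝ}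
    (hu : ∀ i ∈ I, u i ∈ slice A i) {d : (ℝ × ℝ) × (ℝ × ℝ)} (hd : d ∈ (A ×ˢ I) ×ˢ cone A I) :
    shear u d ∈ sector slope (S ×ˢ S) I := by
  obtain ⟨⟨a, i⟩, q⟩ := d
  simp only [mem_product, mem_cone] at hd
  obtain ⟨⟨ha, hi⟩, ⟨hq1, hq2⟩, hq⟩ := hd
  obtain ⟨hu1, hu2⟩ := mem_slice.1 (hu i hi)
  have e : shear u ((a, i), q) = (a * u i + q.1, i * (a * u i) + slope q * q.1) := by
    rw [slope_mul_fst (hA _ hq1)]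
    rfl
  rw [e]
  refine mem_sector_of_add hi hq (mul_pos (hA a ha) (hA _ hu1)) (hA _ hq1)
    (mem_product.2 ⟨hS a ha _ hu1 _ hq1, ?_⟩)
  rw [slope_mul_fst (hA _ hq1)]
  simpa [mul_left_comm] using hS a ha _ hu2 _ hq2

section Shear

variable {A I : Finset ℝ} {u : ℝ → ℝ}

lemma card_shear_collisions_le (hA : ∀ a ∈ A, 0 < a)
    (hu : ∀ i ∈ I, u i ∈ slice A i) :
    #{p ∈ ((A ×ˢ I) ×ˢ cone A I) ×ˢ ((A ×ˢ I) ×ˢ cone A I) | shear u p.1 = shear u p.2} ≤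
      #A * #I * #(cone A I) + #(cone A I) ^ 2 * #A + #(cone A I) ^ 2 * #I ^ 2 := by
  classical
  have hu0 : ∀ i ∈ I, u i ≠ 0 := fun i hi => (hA _ (mem_slice.1 (hu i hi)).1).ne'
  set D := (A ×ˢ I) ×ˢ cone A I with hD
  set C := {p ∈ D ×ˢ D | shear u p.1 = shear u p.2} with hC
  have hC' : ∀ {a i a' k : ℝ} {q q' : ℝ × ℝ}, (((a, i), q), ((a', k), q')) ∈ C →
      (((a ∈ A ∧ i ∈ I) ∧ q ∈ cone A I) ∧ (a' ∈ A ∧ k ∈ I) ∧ q' ∈ cone A I) ∧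
        a * u i + q.1 = a' * u k + q'.1 ∧ i * (a * u i) + q.2 = k * (a' * u k) + q'.2 := by
    intro a i a' k q q' h
    simpa only [hC, hD, mem_filter, mem_product, shear, Prod.mk.injEq] using h
  have hsplit : C ⊆ {p ∈ C | p.1.1.2 = p.2.1.2 ∧ p.1.2 = p.2.2} ∪
      ({p ∈ C | p.1.1.2 = p.2.1.2 ∧ p.1.2 ≠ p.2.2} ∪ {p ∈ C | p.1.1.2 ≠ p.2.1.2}) := by
    intro p hp
    simp only [mem_union, mem_filter]
    tauto
  have h1 : #{p ∈ C | p.1.1.2 = p.2.1.2 ∧ p.1.2 = p.2.2} ≤ #D := by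
    refine card_le_card_of_injOn (fun p => p.1) ?_ ?_
    · intro p hp
      exact (mem_product.1 (mem_filter.1 (mem_filter.1 hp).1).1).1
    · rintro ⟨⟨⟨a, i⟩, q⟩, ⟨a', k⟩, q'⟩ hp ⟨⟨⟨b, j⟩, r⟩, ⟨b', l⟩, r'⟩ hp' e
      simp only [mem_coe, mem_filter] at hp hp'
      obtain ⟨hp, rfl, rfl⟩ := hp
      obtain ⟨hp', rfl, rfl⟩ := hp'
      simp only [Prod.mk.injEq] at e
      obtain ⟨⟨rfl, rfl⟩, rfl⟩ := e
      obtain ⟨⟨⟨⟨-, hi⟩, -⟩, -⟩, h2, -⟩ := hC' hp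
      obtain ⟨-, h2', -⟩ := hC' hp'
      have : a' = b' := mul_right_cancel₀ (hu0 i hi) (by linarith)
      rw [this]
  have h2 : #{p ∈ C | p.1.1.2 = p.2.1.2 ∧ p.1.2 ≠ p.2.2} ≤
      #((cone A I ×ˢ cone A I) ×ˢ A) := by
    refine card_le_card_of_injOn (fun p => ((p.1.2, p.2.2), p.1.1.1)) ?_ ?_
    · rintro ⟨⟨⟨a, i⟩, q⟩, ⟨a', k⟩, q'⟩ hp
      obtain ⟨⟨⟨⟨ha, -⟩, hq⟩, -, hq'⟩, -⟩ := hC' (mem_filter.1 hp).1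
      exact mem_product.2 ⟨mem_product.2 ⟨hq, hq'⟩, ha⟩
    · rintro ⟨⟨⟨a, i⟩, q⟩, ⟨a', k⟩, q'⟩ hp ⟨⟨⟨b, j⟩, r⟩, ⟨b', l⟩, r'⟩ hp' e
      simp only [mem_coe, mem_filter] at hp hp'
      obtain ⟨hp, rfl, hne⟩ := hp
      obtain ⟨hp', rfl, -⟩ := hp'
      simp only [Prod.mk.injEq] at e
      obtain ⟨⟨rfl, rfl⟩, rfl⟩ := e
      obtain ⟨⟨⟨⟨-, hi⟩, -⟩, -⟩, e1, e2⟩ := hC' hp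
      obtain ⟨⟨⟨⟨-, hj⟩, -⟩, -⟩, e1', e2'⟩ := hC' hp'
      have hq1 : q'.1 - q.1 ≠ 0 := by
        intro h0
        have h3 : a * u i = a' * u i := by linarith
        apply hne
        exact Prod.ext (by linarith) (by rw [h3] at e2; linarith)
      have hij : i = j := by
        apply mul_right_cancel₀ hq1
        linear_combination e2 - e2' - i * e1 + j * e1'
      subst hij
      have : a' = b' := mul_right_cancel₀ (hu0 i hi) (by linarith)
      rw [this]
  have h3 : #{p ∈ C | p.1.1.2 ≠ p.2.1.2} ≤ #((cone A I ×ˢ cone A I) ×ˢ (I ×ˢ I)) := by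
    refine card_le_card_of_injOn (fun p => ((p.1.2, p.2.2), (p.1.1.2, p.2.1.2))) ?_ ?_
    · rintro ⟨⟨⟨a, i⟩, q⟩, ⟨a', k⟩, q'⟩ hp
      obtain ⟨⟨⟨⟨-, hi⟩, hq⟩, ⟨-, hk⟩, hq'⟩, -⟩ := hC' (mem_filter.1 hp).1
      exact mem_product.2 ⟨mem_product.2 ⟨hq, hq'⟩, mem_product.2 ⟨hi, hk⟩⟩
    · rintro ⟨⟨⟨a, i⟩, q⟩, ⟨a', k⟩, q'⟩ hp ⟨⟨⟨b, j⟩, r⟩, ⟨b', l⟩, r'⟩ hp' e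
      simp only [mem_coe, mem_filter] at hp hp'
      obtain ⟨hp, hne⟩ := hp
      simp only [Prod.mk.injEq] at e
      obtain ⟨⟨rfl, rfl⟩, rfl, rfl⟩ := e
      obtain ⟨⟨⟨⟨-, hi⟩, -⟩, ⟨-, hk⟩, -⟩, e1, e2⟩ := hC' hp
      obtain ⟨-, e1', e2'⟩ := hC' hp'.1
      have hik : i - k ≠ 0 := sub_ne_zero.2 hne
      have ha : a = b := by
        apply mul_right_cancel₀ (hu0 i hi)
        apply mul_left_cancel₀ hik
        linear_combination e2 - e2' - k * e1 + k * e1'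
      subst ha
      have : a' = b' := mul_right_cancel₀ (hu0 k hk) (by linarith)
      rw [this]
  have h4 := (card_le_card hsplit).trans (card_union_le _ _)
  have h5 := card_union_le {p ∈ C | p.1.1.2 = p.2.1.2 ∧ p.1.2 ≠ p.2.2} {p ∈ C | p.1.1.2 ≠ p.2.1.2}
  simp only [hD, card_product] at h1 h2 h3
  nlinarith

/-- Slopes with few representations: a cluster of them carries many points. -/
lemma low_cluster {S : Finset ℝ} {M : ℝ} (hM : 0 < M) (hA : ∀ a ∈ A, 0 < a) (hA0 : A.Nonempty)
    (hS : ∀ a ∈ A, ∀ b ∈ A, ∀ c ∈ A, a * b + c ∈ S)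
    (hI' : ∀ i ∈ I, (slice A i).Nonempty) (hMI : M ≤ #I) (hR1 : M * #(cone A I) ≤ (#I : ℝ) ^ 2)
    (hR2 : M * #(cone A I) ≤ #A) :
    M * #A / 3 * #(cone A I) ≤ #(sector slope (S ×ˢ S) I) := by
  classical
  have hch : ∀ i : ℝ, ∃ x : ℝ, i ∈ I → x ∈ slice A i := by
    intro i
    by_cases hi : i ∈ I
    · obtain ⟨x, hx⟩ := hI' i hi
      exact ⟨x, fun _ => hx⟩
    · exact ⟨0, fun h => absurd h hi⟩
  choose u hu using hch
  have h1 := card_sq_le_card_mul_collisions ((A ×ˢ I) ×ˢ cone A I) (sector slope (S ×ˢ S) I)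
    (shear u) (fun d hd => shear_mem_sector hA hS hu hd)
  have h2 := h1.trans (Nat.mul_le_mul_left _ (card_shear_collisions_le hA hu))
  simp only [card_product] at h2
  have h3 : ((#A * #I * #(cone A I) : ℝ)) ^ 2 ≤ #(sector slope (S ×ˢ S) I) *
      (#A * #I * #(cone A I) + #(cone A I) ^ 2 * #A + #(cone A I) ^ 2 * #I ^ 2) := by
    exact_mod_cast h2
  have hN : (0 : ℝ) < #A := by exact_mod_cast hA0.card_pos
  have hL : (0 : ℝ) < #I := lt_of_lt_of_le hM hMI
  have hP0 : (0 : ℝ) ≤ #(sector slope (S ×ˢ S) I) := by positivity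
  have hR0 : (0 : ℝ) ≤ #(cone A I) := by positivity
  generalize (#(sector slope (S ×ˢ S) I) : ℝ) = P at *
  generalize (#(cone A I) : ℝ) = R at *
  generalize (#A : ℝ) = N at *
  generalize (#I : ℝ) = L at *
  rcases hR0.eq_or_lt with rfl | hR
  · simpa using hP0
  have hT : M * (N * L * R + R ^ 2 * N + R ^ 2 * L ^ 2) ≤ 3 * (N * L ^ 2 * R) := by
    have t1 : M * (N * L * R) ≤ L * (N * L * R) := by gcongr
    have t2 : (M * R) * (R * N) ≤ L ^ 2 * (R * N) := by gcongr
    have t3 : (M * R) * (R * L ^ 2) ≤ N * (R * L ^ 2) := by gcongr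
    linarith
  have h4 : (M * N * R) * (N * L ^ 2 * R) ≤ (3 * P) * (N * L ^ 2 * R) := by
    calc (M * N * R) * (N * L ^ 2 * R) = M * (N * L * R) ^ 2 := by ring
      _ ≤ M * (P * (N * L * R + R ^ 2 * N + R ^ 2 * L ^ 2)) := by gcongr
      _ = P * (M * (N * L * R + R ^ 2 * N + R ^ 2 * L ^ 2)) := by ring
      _ ≤ P * (3 * (N * L ^ 2 * R)) := by gcongr
      _ = _ := by ring
  have := le_of_mul_le_mul_right h4 (by positivity)
  linarith

set_option maxHeartbeats 1000000 in
/-- Pairs of summands with four slopes that do not match up: these are controlled by the number of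
solutions of linear equations in `A`. -/
lemma card_shear_collisions_of_ne_le {M : ℕ} {T : ℝ} (hA : ∀ a ∈ A, 0 < a)
    (hu : ∀ i ∈ I, u i ∈ slice A i) (hM : #I = M)
    (hT : ∀ j ∈ I, ∀ s s' : ℝ, s ≠ 0 → s' ≠ 0 →
      T * #{q ∈ A ×ˢ slice A j | s * q.1 + s' * q.2 ∈ A} ≤ #(slice A j) * #A) (hT0 : 0 ≤ T) :
    T * #{p ∈ ((A ×ˢ I) ×ˢ cone A I) ×ˢ ((A ×ˢ I) ×ˢ cone A I) |
      shear u p.1 = shear u p.2 ∧ p.1.1.2 ≠ slope p.1.2 ∧ p.2.1.2 ≠ slope p.2.2 ∧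
        p.1.1.2 ≠ slope p.2.2 ∧ ¬ (p.1.1.2 = p.2.1.2 ∧ slope p.1.2 = slope p.2.2)} ≤
      M ^ 3 * (#(cone A I) * #A) := by
  classical
  have hu0 : ∀ i ∈ I, u i ≠ 0 := fun i hi => (hA _ (mem_slice.1 (hu i hi)).1).ne'
  set D := (A ×ˢ I) ×ˢ cone A I with hD
  set C := {p ∈ D ×ˢ D | shear u p.1 = shear u p.2 ∧ p.1.1.2 ≠ slope p.1.2 ∧
    p.2.1.2 ≠ slope p.2.2 ∧ p.1.1.2 ≠ slope p.2.2 ∧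
      ¬ (p.1.1.2 = p.2.1.2 ∧ slope p.1.2 = slope p.2.2)} with hC
  set g : ((ℝ × ℝ) × (ℝ × ℝ)) × ((ℝ × ℝ) × (ℝ × ℝ)) → (ℝ × ℝ × ℝ) × ℝ :=
    fun p => ((p.1.1.2, p.2.1.2, slope p.2.2), slope p.1.2) with hg
  have hmem : ∀ {a i a' k : ℝ} {q q' : ℝ × ℝ}, (((a, i), q), ((a', k), q')) ∈ C →
      ((a ∈ A ∧ i ∈ I) ∧ q ∈ cone A I) ∧ ((a' ∈ A ∧ k ∈ I) ∧ q' ∈ cone A I) ∧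
        a * u i + q.1 = a' * u k + q'.1 ∧
        i * (a * u i) + slope q * q.1 = k * (a' * u k) + slope q' * q'.1 ∧
        i ≠ slope q ∧ k ≠ slope q' ∧ i ≠ slope q' ∧ ¬ (i = k ∧ slope q = slope q') := by
    intro a i a' k q q' h
    simp only [hC, hD, mem_filter, mem_product, shear, Prod.mk.injEq] at h
    obtain ⟨⟨⟨h1, h2⟩, h3, h4⟩, ⟨h5, h6⟩, h7⟩ := h
    rw [slope_mul_fst (hA _ (mem_cone.1 h2).1.1), slope_mul_fst (hA _ (mem_cone.1 h4).1.1)]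
    exact ⟨⟨h1, h2⟩, ⟨h3, h4⟩, h5, h6, h7⟩
  have hmaps : ∀ p ∈ C, g p ∈ (I ×ˢ I ×ˢ I) ×ˢ I := by
    rintro ⟨⟨⟨a, i⟩, q⟩, ⟨a', k⟩, q'⟩ hp
    obtain ⟨⟨⟨-, hi⟩, hq⟩, ⟨⟨-, hk⟩, hq'⟩, -⟩ := hmem hp
    simp only [hg, mem_product]
    exact ⟨⟨hi, hk, (mem_cone.1 hq').2⟩, (mem_cone.1 hq).2⟩
  have hfib : ∀ c ∈ (I ×ˢ I ×ˢ I) ×ˢ I, T * #{p ∈ C | g p = c} ≤ #(slice A c.2) * #A := by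
    rintro ⟨⟨i, k, l⟩, j⟩ hc
    simp only [mem_product] at hc
    obtain ⟨⟨hi, hk, hl⟩, hj⟩ := hc
    have hmem' : ∀ {a i' a' k' : ℝ} {q q' : ℝ × ℝ},
        (((a, i'), q), ((a', k'), q')) ∈ ({p ∈ C | g p = ((i, k, l), j)} : Finset _) →
        i' = i ∧ k' = k ∧ slope q' = l ∧ slope q = j ∧ a ∈ A ∧ a' ∈ A ∧ q.1 ∈ slice A j ∧
        q'.1 ∈ A ∧ q.2 = j * q.1 ∧ q'.2 = l * q'.1 ∧
        a * u i + q.1 = a' * u k + q'.1 ∧ i * (a * u i) + j * q.1 = k * (a' * u k) + l * q'.1 ∧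
        i ≠ j ∧ k ≠ l ∧ i ≠ l ∧ ¬ (i = k ∧ j = l) := by
      intro a i' a' k' q q' hp
      obtain ⟨hpC, e⟩ := mem_filter.1 hp
      simp only [hg, Prod.mk.injEq] at e
      obtain ⟨⟨rfl, rfl, rfl⟩, rfl⟩ := e
      obtain ⟨⟨⟨ha, -⟩, hq⟩, ⟨⟨ha', -⟩, hq'⟩, h⟩ := hmem hpC
      have hq1 := (mem_cone.1 hq).1
      have hq1' := (mem_cone.1 hq').1
      have e := slope_mul_fst (hA _ hq1.1)
      have e' := slope_mul_fst (hA _ hq1'.1)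
      refine ⟨rfl, rfl, rfl, rfl, ha, ha', mem_slice.2 ⟨hq1.1, ?_⟩, hq1'.1, e.symm, e'.symm, h⟩
      rw [e]
      exact hq1.2
    by_cases hne : i ≠ j ∧ k ≠ l ∧ i ≠ l ∧ ¬ (i = k ∧ j = l)
    swap
    · have : ({p ∈ C | g p = ((i, k, l), j)} : Finset _) = ∅ := by
        rw [eq_empty_iff_forall_notMem]
        rintro ⟨⟨⟨a, i'⟩, q⟩, ⟨a', k'⟩, q'⟩ hp
        obtain ⟨-, -, -, -, -, -, -, -, -, -, -, -, h⟩ := hmem' hp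
        exact hne h
      rw [this]
      simp only [card_empty, Nat.cast_zero, mul_zero]
      positivity
    obtain ⟨-, hkl, hil, hne⟩ := hne
    have hkl' : (k - l) * u k ≠ 0 := mul_ne_zero (sub_ne_zero.2 hkl) (hu0 k hk)
    have hinj : Set.InjOn (fun p : ((ℝ × ℝ) × (ℝ × ℝ)) × ((ℝ × ℝ) × (ℝ × ℝ)) =>
        (p.1.1.1, p.1.2.1)) ({p ∈ C | g p = ((i, k, l), j)} : Finset _) := by
      rintro ⟨⟨⟨a, i'⟩, q⟩, ⟨a', k'⟩, q'⟩ hp ⟨⟨⟨b, m⟩, r⟩, ⟨b', m'⟩, r'⟩ hp' e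
      obtain ⟨rfl, rfl, -, -, -, -, -, -, hq, hq', e1, e2, -⟩ := hmem' hp
      obtain ⟨rfl, rfl, -, -, -, -, -, -, hr, hr', e1', e2', -⟩ := hmem' hp'
      simp only [Prod.mk.injEq] at e
      obtain ⟨rfl, e⟩ := e
      rw [← e] at hr e1' e2'
      have hqr : q = r := Prod.ext e (hq.trans hr.symm)
      have ha : a' = b' := by
        apply mul_left_cancel₀ hkl'
        linear_combination e2' - e2 - l * e1' + l * e1
      subst ha
      have hq1 : q'.1 = r'.1 := by linarith
      have hqr' : q' = r' := Prod.ext hq1 (by rw [hq', hr', hq1])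
      rw [hqr, hqr']
    obtain ⟨s, s', hs, hs', hss⟩ : ∃ s s' : ℝ, s ≠ 0 ∧ s' ≠ 0 ∧ ∀ p ∈ C, g p = ((i, k, l), j) →
        s * p.1.1.1 + s' * p.1.2.1 ∈ A := by
      by_cases hjl : j = l
      · have hik : i ≠ k := fun h => hne ⟨h, hjl⟩
        have hlk : l - k ≠ 0 := sub_ne_zero.2 hkl.symm
        refine ⟨(i - k) * u i / (l - k), 1,
          div_ne_zero (mul_ne_zero (sub_ne_zero.2 hik) (hu0 i hi)) hlk, one_ne_zero, ?_⟩
        rintro ⟨⟨⟨a, i'⟩, q⟩, ⟨a', k'⟩, q'⟩ hp he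
        obtain ⟨-, -, -, -, -, -, -, hq', -, -, e1, e2, -⟩ := hmem' (mem_filter.2 ⟨hp, he⟩)
        convert hq' using 1
        rw [hjl] at e2
        rw [div_mul_eq_mul_div, one_mul, ← eq_sub_iff_add_eq, div_eq_iff hlk]
        linear_combination e2 - k * e1
      · refine ⟨(i - l) * u i / ((k - l) * u k), (j - l) / ((k - l) * u k),
          div_ne_zero (mul_ne_zero (sub_ne_zero.2 hil) (hu0 i hi)) hkl',
          div_ne_zero (sub_ne_zero.2 hjl) hkl', ?_⟩
        rintro ⟨⟨⟨a, i'⟩, q⟩, ⟨a', k'⟩, q'⟩ hp he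
        obtain ⟨-, -, -, -, -, ha', -, -, -, -, e1, e2, -⟩ := hmem' (mem_filter.2 ⟨hp, he⟩)
        convert ha' using 1
        rw [div_mul_eq_mul_div, div_mul_eq_mul_div, ← add_div, div_eq_iff hkl']
        linear_combination e2 - l * e1
    refine le_trans ?_ (hT j hj s s' hs hs')
    gcongr
    refine card_le_card_of_injOn _ ?_ hinj
    rintro ⟨⟨⟨a, i'⟩, q⟩, ⟨a', k'⟩, q'⟩ hp
    obtain ⟨-, -, -, -, ha, -, hq, -⟩ := hmem' hp
    obtain ⟨hp, he⟩ := mem_filter.1 hp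
    exact mem_filter.2 ⟨mem_product.2 ⟨ha, hq⟩, hss _ hp he⟩
  rw [card_eq_sum_card_fiberwise hmaps, card_cone hA I]
  push_cast
  rw [mul_sum]
  refine (sum_le_sum hfib).trans (le_of_eq ?_)
  rw [sum_product]
  simp only [← sum_mul, sum_const, card_product, hM, nsmul_eq_mul]
  push_cast
  ring

/-- Slopes for which linear equations have few solutions: a cluster of them carries many points. -/
lemma good_cluster {S : Finset ℝ} {M : ℕ} (hM : 2 ≤ M) (hA : ∀ a ∈ A, 0 < a) (hA0 : A.Nonempty)
    (hS : ∀ a ∈ A, ∀ b ∈ A, ∀ c ∈ A, a * b + c ∈ S) (hI' : ∀ i ∈ I, (slice A i).Nonempty)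
    (hMI : #I = M)
    (hT : ∀ j ∈ I, ∀ s s' : ℝ, s ≠ 0 → s' ≠ 0 →
      (M : ℝ) ^ 2 * #{q ∈ A ×ˢ slice A j | s * q.1 + s' * q.2 ∈ A} ≤ #(slice A j) * #A) :
    (M : ℝ) * #A / 16 * #(cone A I) ≤ #(sector slope (S ×ˢ S) I) := by
  classical
  have hch : ∀ i : ℝ, ∃ x : ℝ, i ∈ I → x ∈ slice A i := by
    intro i
    by_cases hi : i ∈ I
    · obtain ⟨x, hx⟩ := hI' i hi
      exact ⟨x, fun _ => hx⟩
    · exact ⟨0, fun h => absurd h hi⟩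
  choose u hu using hch
  have hu0 : ∀ i ∈ I, u i ≠ 0 := fun i hi => (hA _ (mem_slice.1 (hu i hi)).1).ne'
  have hT' := card_shear_collisions_of_ne_le hA hu hMI hT (by positivity)
  set D := (A ×ˢ I) ×ˢ cone A I with hD
  set E := {d ∈ D | d.1.2 ≠ slope d.2} with hE
  set C := {p ∈ D ×ˢ D | shear u p.1 = shear u p.2 ∧ p.1.1.2 ≠ slope p.1.2 ∧
    p.2.1.2 ≠ slope p.2.2 ∧ p.1.1.2 ≠ slope p.2.2 ∧
      ¬ (p.1.1.2 = p.2.1.2 ∧ slope p.1.2 = slope p.2.2)} with hC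
  set B := {p ∈ E ×ˢ E | shear u p.1 = shear u p.2} with hB
  have h1 := card_sq_le_card_mul_collisions E (sector slope (S ×ˢ S) I)
    (shear u) (fun d hd => shear_mem_sector hA hS hu (mem_filter.1 hd).1)
  have hmem : ∀ {a i a' k : ℝ} {q q' : ℝ × ℝ}, (((a, i), q), ((a', k), q')) ∈ B →
      ((a ∈ A ∧ i ∈ I) ∧ q ∈ cone A I) ∧ ((a' ∈ A ∧ k ∈ I) ∧ q' ∈ cone A I) ∧
        a * u i + q.1 = a' * u k + q'.1 ∧
        i * (a * u i) + slope q * q.1 = k * (a' * u k) + slope q' * q'.1 ∧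
        i ≠ slope q ∧ k ≠ slope q' := by
    intro a i a' k q q' h
    simp only [hB, hE, hD, mem_filter, mem_product, shear, Prod.mk.injEq] at h
    obtain ⟨⟨⟨⟨h1, h2⟩, h3⟩, ⟨h4, h5⟩, h6⟩, h7, h8⟩ := h
    rw [slope_mul_fst (hA _ (mem_cone.1 h2).1.1), slope_mul_fst (hA _ (mem_cone.1 h5).1.1)]
    exact ⟨⟨h1, h2⟩, ⟨h4, h5⟩, h7, h8, h3, h6⟩
  have hdiag : #{p ∈ B | p.1.1.2 = p.2.1.2 ∧ slope p.1.2 = slope p.2.2} ≤ #E := by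
    refine card_le_card_of_injOn (fun p => p.1) ?_ ?_
    · intro p hp
      exact (mem_product.1 (mem_filter.1 (mem_filter.1 hp).1).1).1
    · have key : ∀ p ∈ ({p ∈ B | p.1.1.2 = p.2.1.2 ∧ slope p.1.2 = slope p.2.2} : Finset _),
          p.2 = p.1 := by
        rintro ⟨⟨⟨a, i⟩, q⟩, ⟨a', k⟩, q'⟩ hp
        obtain ⟨hp, h1, h2⟩ := mem_filter.1 hp
        obtain ⟨⟨⟨-, hi⟩, hq⟩, ⟨-, hq'⟩, e1, e2, hne, -⟩ := hmem hp
        simp only at h1 h2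
        subst h1
        rw [← h2] at e2
        have ha : a = a' := by
          apply mul_right_cancel₀ (hu0 i hi)
          apply mul_left_cancel₀ (sub_ne_zero.2 hne)
          linear_combination e2 - slope q * e1
        subst ha
        have hq1 : q.1 = q'.1 := by linarith
        have hqq : q = q' := by
          refine Prod.ext hq1 ?_
          rw [← slope_mul_fst (hA _ (mem_cone.1 hq).1.1),
            ← slope_mul_fst (hA _ (mem_cone.1 hq').1.1), h2, hq1]
        rw [hqq]
      intro p hp p' hp' e
      exact Prod.ext e (by rw [key p hp, key p' hp']; exact e)
  have hswap : #{p ∈ B | p.1.1.2 = slope p.2.2 ∧ p.2.1.2 = slope p.1.2} ≤ #E := by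
    refine card_le_card_of_injOn (fun p => p.1) ?_ ?_
    · intro p hp
      exact (mem_product.1 (mem_filter.1 (mem_filter.1 hp).1).1).1
    · have key : ∀ {a i a' k : ℝ} {q q' : ℝ × ℝ}, (((a, i), q), ((a', k), q')) ∈
          ({p ∈ B | p.1.1.2 = slope p.2.2 ∧ p.2.1.2 = slope p.1.2} : Finset _) →
          k = slope q ∧ a' * u k = q.1 ∧ u k ≠ 0 ∧ q'.1 = a * u i ∧ q'.2 = i * (a * u i) := by
        intro a i a' k q q' hp
        obtain ⟨hp, h1, h2⟩ := mem_filter.1 hp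
        obtain ⟨⟨⟨-, hi⟩, hq⟩, ⟨⟨-, hk⟩, hq'⟩, e1, e2, hne, -⟩ := hmem hp
        simp only at h1 h2
        rw [← h1, ← h2] at e2
        rw [← h2] at hne
        have e3 : a * u i = q'.1 := by
          apply mul_left_cancel₀ (sub_ne_zero.2 hne)
          linear_combination e2 - k * e1
        refine ⟨h2, by linarith, hu0 k hk, e3.symm, ?_⟩
        rw [← slope_mul_fst (hA _ (mem_cone.1 hq').1.1), ← h1, e3]
      rintro ⟨⟨⟨a, i⟩, q⟩, ⟨a', k⟩, q'⟩ hp ⟨⟨⟨b, j⟩, r⟩, ⟨b', l⟩, r'⟩ hp' e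
      simp only [Prod.mk.injEq] at e
      obtain ⟨⟨rfl, rfl⟩, rfl⟩ := e
      obtain ⟨rfl, h1, h2, h3, h4⟩ := key hp
      obtain ⟨rfl, h1', -, h3', h4'⟩ := key hp'
      have ha : a' = b' := mul_right_cancel₀ h2 (h1.trans h1'.symm)
      have hq : q' = r' := Prod.ext (h3.trans h3'.symm) (h4.trans h4'.symm)
      rw [ha, hq]
  have hsplit : B ⊆ {p ∈ B | p.1.1.2 = p.2.1.2 ∧ slope p.1.2 = slope p.2.2} ∪
      ({p ∈ B | p.1.1.2 = slope p.2.2 ∧ p.2.1.2 = slope p.1.2} ∪ (C ∪ C.image Prod.swap)) := by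
    intro p hp
    obtain ⟨hp', e⟩ := mem_filter.1 hp
    obtain ⟨h3, h4⟩ := mem_product.1 hp'
    obtain ⟨h3, h5⟩ := mem_filter.1 h3
    obtain ⟨h4, h6⟩ := mem_filter.1 h4
    by_cases c1 : p.1.1.2 = p.2.1.2 ∧ slope p.1.2 = slope p.2.2
    · exact mem_union_left _ (mem_filter.2 ⟨hp, c1⟩)
    refine mem_union_right _ ?_
    by_cases c2 : p.1.1.2 = slope p.2.2
    · by_cases c3 : p.2.1.2 = slope p.1.2
      · exact mem_union_left _ (mem_filter.2 ⟨hp, c2, c3⟩)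
      · refine mem_union_right _ (mem_union_right _ (mem_image.2 ⟨p.swap, mem_filter.2 ?_, by simp⟩))
        refine ⟨mem_product.2 ⟨h4, h3⟩, e.symm, h6, h5, c3, fun h => c1 ⟨h.1.symm, h.2.symm⟩⟩
    · exact mem_union_right _ (mem_union_left _
        (mem_filter.2 ⟨mem_product.2 ⟨h3, h4⟩, e, h5, h6, c2, c1⟩))
  have hBcard : #B ≤ 2 * #E + 2 * #C := by
    have i1 := (card_le_card hsplit).trans (card_union_le _ _)
    have i2 := card_union_le {p ∈ B | p.1.1.2 = slope p.2.2 ∧ p.2.1.2 = slope p.1.2}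
      (C ∪ C.image Prod.swap)
    have i3 := card_union_le C (C.image Prod.swap)
    have i4 : #(C.image Prod.swap) ≤ #C := card_image_le
    omega
  have hEcard : (#E : ℝ) = (M - 1) * #A * #(cone A I) := by
    have hcomp : #{d ∈ D | ¬ d.1.2 ≠ slope d.2} = #A * #(cone A I) := by
      rw [← card_product]
      refine card_nbij' (fun d => (d.1.1, d.2)) (fun p => ((p.1, slope p.2), p.2)) ?_ ?_ ?_ ?_
      · rintro ⟨⟨a, i⟩, q⟩ hd
        simp only [hD, mem_coe, mem_filter, mem_product] at hd ⊢
        exact ⟨hd.1.1.1, hd.1.2⟩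
      · rintro ⟨a, q⟩ hd
        simp only [hD, mem_coe, mem_filter, mem_product] at hd ⊢
        exact ⟨⟨⟨hd.1, (mem_cone.1 hd.2).2⟩, hd.2⟩, by simp⟩
      · rintro ⟨⟨a, i⟩, q⟩ hd
        simp only [mem_coe, mem_filter, ne_eq, not_not] at hd
        rw [hd.2]
      · intro p _
        rfl
    have := card_filter_add_card_filter_not (s := D) (fun d => d.1.2 ≠ slope d.2)
    rw [hcomp, hD, card_product, card_product, hMI] at this
    have h' : (#E + #A * #(cone A I) : ℝ) = #A * M * #(cone A I) := by exact_mod_cast this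
    linarith
  have hM' : (2 : ℝ) ≤ M := by exact_mod_cast hM
  have hN : (0 : ℝ) < #A := by exact_mod_cast hA0.card_pos
  have h1' : (#E : ℝ) ^ 2 ≤ #(sector slope (S ×ˢ S) I) * (2 * #E + 2 * #C) := by
    exact_mod_cast h1.trans (Nat.mul_le_mul_left _ hBcard)
  rw [hEcard] at h1'
  clear hEcard
  have hP0 : (0 : ℝ) ≤ #(sector slope (S ×ˢ S) I) := by positivity
  have hR0 : (0 : ℝ) ≤ #(cone A I) := by positivity
  generalize (#(sector slope (S ×ˢ S) I) : ℝ) = P at *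
  generalize (#(cone A I) : ℝ) = R at *
  generalize (#A : ℝ) = N at *
  generalize (#C : ℝ) = c at *
  generalize (M : ℝ) = m at *
  rcases hR0.eq_or_lt with rfl | hR
  · simpa using hP0
  have hc : c ≤ m * R * N := by
    have hm2 : 0 < m ^ 2 := by positivity
    refine le_of_mul_le_mul_left (hT'.trans (le_of_eq ?_)) hm2
    ring
  have h2 : (m / 2 * N * R) ^ 2 ≤ P * (4 * m * R * N) := by
    calc (m / 2 * N * R) ^ 2 ≤ ((m - 1) * N * R) ^ 2 := by
          gcongr
          linarith
      _ ≤ _ := h1'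
      _ ≤ _ := by
        gcongr
        have : 0 < N * R := by positivity
        linarith
  have h3 : (m * N / 16 * R) * (4 * m * R * N) ≤ P * (4 * m * R * N) := by
    refine le_trans (le_of_eq ?_) h2
    ring
  exact le_of_mul_le_mul_right h3 (by positivity)

end Shear

/-- Slopes with many representations for which some linear equation has many solutions have large
product sets `A * slice A j`. -/
lemma mul_card_le_card_mul_slice {A : Finset ℝ} {M s s' j : ℝ} (hA : ∀ a ∈ A, 0 < a) (hM : 4 ≤ M)
    (hMN : M ^ 800 ≤ #A) (hj : √(#A) / M ^ 2 < #(slice A j)) (hs : s ≠ 0) (hs' : s' ≠ 0)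
    (h : (#(slice A j) * #A : ℝ) < M ^ 2 * #{q ∈ A ×ˢ slice A j | s * q.1 + s' * q.2 ∈ A}) :
    M * #A ≤ #(A * slice A j) := by
  by_contra hlt
  push Not at hlt
  have hM0 : 0 < M := by linarith
  have hM1 : 1 ≤ M := by linarith
  have hN : (0 : ℝ) < #A := lt_of_lt_of_le (by positivity) hMN
  have hkey := card_pow_le_of_card_linear_ge (K := M ^ 2) (A := A) (X := slice A j)
    (by nlinarith) hA (fun x hx => hA x (mem_slice.1 hx).1) (card_pos.1 (by exact_mod_cast hN))
    (card_le_card fun x hx => (mem_slice.1 hx).1)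
    (hlt.le.trans (by gcongr; nlinarith)) hs hs' h.le
  have hq : √(#A : ℝ) ^ 2 = #A := Real.sq_sqrt hN.le
  have hq0 : 0 < √(#A : ℝ) := Real.sqrt_pos.2 hN
  have hqM : M ^ 400 ≤ √(#A : ℝ) := by
    apply Real.le_sqrt_of_sq_le
    rwa [← pow_mul]
  rw [← hq] at hkey
  set q := √(#A : ℝ)
  have h1 : q ^ 13 < q ^ 12 * M ^ 386 := by
    have h2 : q < M ^ 2 * #(slice A j) := by
      rw [div_lt_iff₀ (by positivity)] at hj
      linarith
    calc q ^ 13 < (M ^ 2 * #(slice A j)) ^ 13 := by gcongr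
      _ = M ^ 26 * #(slice A j) ^ 13 := by ring
      _ ≤ M ^ 26 * ((q ^ 2) ^ 6 * (M ^ 2) ^ 180) := by gcongr
      _ = q ^ 12 * (M ^ 26 * M ^ 360) := by
        rw [← pow_mul, ← pow_mul]
        ring
      _ = _ := by rw [← pow_add]
  have h3 : q < M ^ 386 := by
    refine lt_of_mul_lt_mul_left (a := q ^ 12) ?_ (by positivity)
    rwa [← pow_succ]
  have h4 : M ^ 386 ≤ M ^ 400 := pow_le_pow_right₀ hM1 (by norm_num)
  linarith

/-- A set of `⌈q / M⌉` slopes, each with few representations, has a large sector. -/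
lemma thin_cluster {A S I : Finset ℝ} {M L : ℕ} {q t : ℝ} (hA : ∀ a ∈ A, 0 < a)
    (hA0 : A.Nonempty) (hS : ∀ a ∈ A, ∀ b ∈ A, ∀ c ∈ A, a * b + c ∈ S) (hM : 2 ≤ M)
    (hqM : (M : ℝ) ^ 2 ≤ q) (hq : q ^ 2 = #A) (ht : t = q / (M : ℝ) ^ 2) (hL : L = ⌈q / M⌉₊)
    (hI : #I = L) (hne : ∀ i ∈ I, (slice A i).Nonempty)
    (hIt : ∀ i ∈ I, (#(slice A i) : ℝ) ≤ t) :
    M * #A / 16 * (#(cone A I) : ℝ) ≤ #(sector slope (S ×ˢ S) I) := by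
  have hM' : (2 : ℝ) ≤ M := by exact_mod_cast hM
  have hM0 : (0 : ℝ) < M := by linarith
  have hq0 : 0 < q := lt_of_lt_of_le (by positivity) hqM
  have hqM1 : 1 ≤ q / M := by
    rw [one_le_div hM0]
    nlinarith
  have hL1 : q / M ≤ L := hL ▸ Nat.le_ceil _
  have hL2 : (L : ℝ) ≤ 2 * (q / M) := by
    have := Nat.ceil_lt_add_one (a := q / M) (by positivity)
    rw [← hL] at this
    linarith
  have hML : (M : ℝ) ≤ L := by
    refine le_trans ?_ hL1
    rw [le_div_iff₀ hM0]
    nlinarith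
  have hR : (#(cone A I) : ℝ) ≤ L * t := by
    rw [card_cone hA I, ← hI, ← nsmul_eq_mul]
    push_cast
    exact sum_le_card_nsmul _ _ _ hIt
  have hMR : (M : ℝ) * #(cone A I) ≤ L * (q / M) := by
    calc (M : ℝ) * #(cone A I) ≤ M * (L * t) := by gcongr
      _ = L * (q / M) := by
        rw [ht]
        field_simp
  have h1 : (M : ℝ) * #(cone A I) ≤ (#I : ℝ) ^ 2 := by
    rw [hI]
    calc (M : ℝ) * #(cone A I) ≤ L * (q / M) := hMR
      _ ≤ L * L := by gcongr
      _ = (L : ℝ) ^ 2 := by ring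
  have h2 : (M : ℝ) * #(cone A I) ≤ #A := by
    calc (M : ℝ) * #(cone A I) ≤ L * (q / M) := hMR
      _ ≤ 2 * (q / M) * (q / M) := by gcongr
      _ = 2 / M ^ 2 * q ^ 2 := by ring
      _ ≤ 1 * q ^ 2 := by
        gcongr
        rw [div_le_one (by positivity)]
        nlinarith
      _ = #A := by rw [one_mul, hq]
  have h := low_cluster hM0 hA hA0 hS hne (by rwa [hI]) h1 h2
  refine le_trans ?_ h
  gcongr
  norm_num

lemma mul_card_pow_three_le {A S : Finset ℝ} {M : ℕ} (hA : ∀ a ∈ A, 0 < a) (hM : 4 ≤ M)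
    (hMN : (M : ℝ) ^ 800 ≤ #A) (hS : ∀ a ∈ A, ∀ b ∈ A, ∀ c ∈ A, a * b + c ∈ S) :
    (M : ℝ) * #A ^ 3 / 96 ≤ #S ^ 2 := by
  classical
  have hM' : (4 : ℝ) ≤ M := by exact_mod_cast hM
  have hM0 : (0 : ℝ) < M := by linarith
  have hM1 : (1 : ℝ) ≤ M := by linarith
  have hN : (0 : ℝ) < #A := lt_of_lt_of_le (by positivity) hMN
  have hA0 : A.Nonempty := card_pos.1 (by exact_mod_cast hN)
  have hq : √(#A : ℝ) ^ 2 = #A := Real.sq_sqrt hN.le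
  have hqM : (M : ℝ) ^ 2 ≤ √(#A : ℝ) := by
    apply Real.le_sqrt_of_sq_le
    rw [← pow_mul]
    exact (pow_le_pow_right₀ hM1 (by norm_num)).trans hMN
  have hN4 : 64 * (M : ℝ) ≤ #A := by
    calc 64 * (M : ℝ) = 4 ^ 3 * M := by norm_num
      _ ≤ (M : ℝ) ^ 3 * M := by gcongr
      _ = (M : ℝ) ^ 4 := by ring
      _ ≤ (M : ℝ) ^ 800 := pow_le_pow_right₀ hM1 (by norm_num)
      _ ≤ _ := hMN
  have hlarge' := fun (j s s' : ℝ) =>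
    mul_card_le_card_mul_slice (s := s) (s' := s') (j := j) hA hM' hMN
  clear hMN
  obtain ⟨q, hqdef⟩ : ∃ q : ℝ, q = √(#A : ℝ) := ⟨_, rfl⟩
  rw [← hqdef] at hq hqM
  have hq0 : 0 < q := lt_of_lt_of_le (by positivity) hqM
  set Λ := (A ×ˢ A).image slope with hΛ
  have hne : ∀ i ∈ Λ, (slice A i).Nonempty := by
    intro i hi
    obtain ⟨p, hp, rfl⟩ := mem_image.1 hi
    obtain ⟨h1, h2⟩ := mem_product.1 hp
    exact ⟨p.1, mem_slice.2 ⟨h1, by rwa [slope_mul_fst (hA _ h1)]⟩⟩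
  have htotal : ∑ i ∈ Λ, (#(slice A i) : ℝ) = #A ^ 2 := by
    have e : cone A Λ = A ×ˢ A := by
      ext p
      rw [mem_cone, mem_product]
      exact ⟨fun h => h.1, fun h => ⟨h, mem_image_of_mem _ (mem_product.2 h)⟩⟩
    have := card_cone hA Λ
    rw [e, card_product] at this
    rw [sq]
    exact_mod_cast this.symm
  have hcone : ∀ I : Finset ℝ, (#(cone A I) : ℝ) = ∑ i ∈ I, (#(slice A i) : ℝ) := fun I => by
    exact_mod_cast card_cone hA I
  have hsliceN : ∀ i, (#(slice A i) : ℝ) ≤ #A := fun i => by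
    exact_mod_cast card_le_card fun x hx => (mem_slice.1 hx).1
  obtain ⟨t, ht⟩ : ∃ t : ℝ, t = q / (M : ℝ) ^ 2 := ⟨_, rfl⟩
  have ht0 : 0 ≤ t := by
    rw [ht]
    exact div_nonneg hq0.le (sq_nonneg _)
  set good : ℝ → Prop := fun j => ∀ s s' : ℝ, s ≠ 0 → s' ≠ 0 →
    (M : ℝ) ^ 2 * #{q ∈ A ×ˢ slice A j | s * q.1 + s' * q.2 ∈ A} ≤ #(slice A j) * #A with hgood
  set Λ₁ := {i ∈ Λ | (#(slice A i) : ℝ) ≤ t} with hΛ₁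
  set Λ' := {i ∈ Λ | ¬ (#(slice A i) : ℝ) ≤ t} with hΛ'
  set Λ₂ := {i ∈ Λ' | good i} with hΛ₂
  set Λ₃ := {i ∈ Λ' | ¬ good i} with hΛ₃
  have hsum : ∑ i ∈ Λ₁, (#(slice A i) : ℝ) + (∑ i ∈ Λ₂, (#(slice A i) : ℝ) +
      ∑ i ∈ Λ₃, (#(slice A i) : ℝ)) = #A ^ 2 := by
    rw [sum_filter_add_sum_filter_not, sum_filter_add_sum_filter_not, htotal]
  obtain ⟨f, hf⟩ : ∃ f : ℝ, f = M * #A / 16 := ⟨_, rfl⟩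
  have hf0 : 0 < f := by
    rw [hf]
    positivity
  have hSS : (#(S ×ˢ S) : ℝ) = #S ^ 2 := by
    rw [card_product, sq]
    push_cast
    rfl
  have hlow : f * (∑ i ∈ Λ₁, (#(slice A i) : ℝ) - #A ^ 2 / 6) ≤ #S ^ 2 := by
    have hqM1 : 1 ≤ q / M := by
      rw [one_le_div hM0]
      nlinarith
    obtain ⟨L, hL⟩ : ∃ L : ℕ, L = ⌈q / M⌉₊ := ⟨_, rfl⟩
    have hL1 : q / M ≤ L := hL ▸ Nat.le_ceil _
    have hL2 : (L : ℝ) ≤ 2 * (q / M) := by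
      have := Nat.ceil_lt_add_one (a := q / M) (by positivity)
      rw [← hL] at this
      linarith
    have hML : (M : ℝ) ≤ L := by
      refine le_trans ?_ hL1
      rw [le_div_iff₀ hM0]
      nlinarith
    have h := mul_sum_sub_le_card slope (fun i => (#(slice A i) : ℝ)) (f := f) (ν := t) (M := L)
      (by
        have : (1 : ℝ) ≤ L := hM1.trans hML
        exact_mod_cast this) hf0.le ht0 Λ₁
      (fun i hi => (mem_filter.1 hi).2) (S ×ˢ S) (fun I hI hcard => by
        rw [hf, ← hcone]
        exact thin_cluster hA hA0 hS (by omega) hqM hq ht hL hcard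
          (fun i hi => hne i (mem_filter.1 (hI hi)).1)
          (fun i hi => (mem_filter.1 (hI hi)).2))
    rw [hSS] at h
    refine le_trans ?_ h
    gcongr
    calc L * t ≤ 2 * (q / M) * (q / M ^ 2) := by
          rw [← ht]
          gcongr
      _ = 2 / M ^ 3 * q ^ 2 := by
        field_simp
      _ ≤ 1 * q ^ 2 := by
        gcongr
        rw [div_le_one (by positivity)]
        have : (4 : ℝ) ^ 3 ≤ M ^ 3 := by gcongr
        linarith
      _ = #A := by rw [one_mul, hq]
      _ ≤ #A ^ 2 / 6 := by nlinarith
  have hgood' : f * (∑ i ∈ Λ₂, (#(slice A i) : ℝ) - #A ^ 2 / 6) ≤ #S ^ 2 := by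
    have h := mul_sum_sub_le_card slope (fun i => (#(slice A i) : ℝ)) (f := f) (ν := #A) (M := M)
      (by omega) hf0.le hN.le Λ₂ (fun i _ => hsliceN i) (S ×ˢ S) (by
        intro I hI hcard
        rw [hf, ← hcone]
        exact good_cluster (by omega) hA hA0 hS
          (fun i hi => hne i (mem_filter.1 (mem_filter.1 (hI hi)).1).1) hcard
          (fun j hj => (mem_filter.1 (hI hj)).2))
    rw [hSS] at h
    refine le_trans ?_ h
    gcongr
    nlinarith
  have hbad : f * (∑ i ∈ Λ₃, (#(slice A i) : ℝ) - #A ^ 2 / 6) ≤ #S ^ 2 := by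
    have hlarge : ∀ j ∈ Λ₃, (M : ℝ) * #A ≤ #(A * slice A j) := by
      intro j hj
      obtain ⟨hj1, hj2⟩ := mem_filter.1 hj
      have hj3 := (mem_filter.1 hj1).2
      simp only [hgood] at hj2
      push Not at hj2 hj3
      obtain ⟨s, s', hs, hs', h⟩ := hj2
      rw [ht, hqdef] at hj3
      exact hlarge' j s s' hj3 hs hs' h
    have h := mul_sum_sub_le_card slope (fun i => (#(slice A i) : ℝ)) (f := f) (ν := #A) (M := 2)
      (by omega) hf0.le hN.le Λ₃ (fun i _ => hsliceN i) (S ×ˢ S) (by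
        intro I hI hcard
        obtain ⟨i, j, hij, rfl⟩ := card_eq_two.1 hcard
        rw [sum_pair hij]
        have hi : i ∈ ({i, j} : Finset ℝ) := by simp
        have hj : j ∈ ({i, j} : Finset ℝ) := by simp
        have h1 := card_mul_slice_mul_le hA hS hi hj hij
        have h2 := card_mul_slice_mul_le hA hS hj hi hij.symm
        have h1' : (#(A * slice A i) * #(slice A j) : ℝ) ≤ #(sector slope (S ×ˢ S) {i, j}) := by
          exact_mod_cast h1
        have h2' : (#(A * slice A j) * #(slice A i) : ℝ) ≤ #(sector slope (S ×ˢ S) {i, j}) := by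
          exact_mod_cast h2
        have h3 : (M : ℝ) * #A * #(slice A j) ≤ #(A * slice A i) * #(slice A j) := by
          gcongr
          exact hlarge i (hI hi)
        have h4 : (M : ℝ) * #A * #(slice A i) ≤ #(A * slice A j) * #(slice A i) := by
          gcongr
          exact hlarge j (hI hj)
        rw [hf]
        have : (0 : ℝ) ≤ #(sector slope (S ×ˢ S) {i, j}) := by positivity
        linarith)
    rw [hSS] at h
    refine le_trans ?_ h
    gcongr
    push_cast
    nlinarith
  have : f * (#A ^ 2 / 2) ≤ 3 * #S ^ 2 := by
    rw [← hsum] at hlow hgood' hbad ⊢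
    linarith
  rw [hf] at this
  linarith

lemma rpow_card_le {A S : Finset ℝ} (hA : ∀ a ∈ A, 0 < a) (hN : (4 : ℝ) ^ 800 ≤ #A)
    (hS : ∀ a ∈ A, ∀ b ∈ A, ∀ c ∈ A, a * b + c ∈ S) :
    (#A : ℝ) ^ ((3 : ℝ) / 2 + 1 / 1600) / 14 ≤ #S := by
  have hN0 : (0 : ℝ) < #A := lt_of_lt_of_le (by positivity) hN
  obtain ⟨x, hx⟩ : ∃ x : ℝ, x = (#A : ℝ) ^ ((1 : ℝ) / 800) := ⟨_, rfl⟩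
  have hx800 : x ^ 800 = #A := by
    rw [hx, ← Real.rpow_natCast, ← Real.rpow_mul hN0.le]
    norm_num
  have hx0 : 0 ≤ x := by
    rw [hx]
    positivity
  have hx4 : 4 ≤ x := by
    rw [← hx800] at hN
    exact (pow_le_pow_iff_left₀ (by norm_num) hx0 (by norm_num)).1 hN
  have hM4 : 4 ≤ ⌊x⌋₊ := Nat.le_floor (by exact_mod_cast hx4)
  have hMx : (⌊x⌋₊ : ℝ) ≤ x := Nat.floor_le hx0
  have hxM : x ≤ 2 * ⌊x⌋₊ := by
    have h1 := Nat.lt_floor_add_one x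
    have h2 : (4 : ℝ) ≤ ⌊x⌋₊ := by exact_mod_cast hM4
    linarith
  have hmain := mul_card_pow_three_le hA hM4
    ((pow_le_pow_left₀ (by positivity) hMx 800).trans hx800.le) hS
  refine (pow_le_pow_iff_left₀ (by positivity) (by positivity) two_ne_zero).1
    (le_trans ?_ hmain)
  have e : ((#A : ℝ) ^ ((3 : ℝ) / 2 + 1 / 1600)) ^ 2 = #A ^ 3 * x := by
    rw [hx, ← Real.rpow_natCast, ← Real.rpow_mul hN0.le, ← Real.rpow_natCast,
      ← Real.rpow_add hN0]
    norm_num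
  rw [div_pow, e]
  have h3 : (#A : ℝ) ^ 3 * x ≤ #A ^ 3 * (2 * ⌊x⌋₊) := by gcongr
  have h4 : (0 : ℝ) ≤ #A ^ 3 * ⌊x⌋₊ := by positivity
  linarith

end SumProduct

/-- There is `c > 0` such that for every `0 < δ ≤ 1` there are `C > 0` and `n₀ ≥ 1`:
for every finite set `A` of reals with `|A| ≥ n₀` having at least `δ·|A|` strictly
negative elements, `|AA−A| ≥ C·|A|^(3/2 + c)`. -/
theorem lower_bound_AA_sub_A_of_negative_proportion :
    ∃ c : ℝ, 0 < c ∧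
      ∀ δ : ℝ, 0 < δ → δ ≤ 1 →
        ∃ C : ℝ, 0 < C ∧ ∃ n₀ : ℕ, 0 < n₀ ∧
          ∀ A : Finset ℝ, n₀ ≤ A.card →
            δ * (A.card : ℝ) ≤ ((A.filter (fun a => a < 0)).card : ℝ) →
            C * (A.card : ℝ) ^ ((3 : ℝ) / 2 + c) ≤
              (((A ×ˢ A ×ˢ A).image
                (fun p : ℝ × ℝ × ℝ => p.1 * p.2.1 - p.2.2)).card : ℝ) := by
  refine ⟨1 / 1600, by norm_num, fun δ hδ _ => ⟨δ ^ ((3 : ℝ) / 2 + 1 / 1600) / 14,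
    by positivity, ⌈(4 : ℝ) ^ 800 / δ⌉₊, Nat.ceil_pos.2 (by positivity), fun A hA hneg => ?_⟩⟩
  have hA' : (4 : ℝ) ^ 800 ≤ δ * A.card := by
    have := Nat.ceil_le.1 hA
    rw [div_le_iff₀ hδ] at this
    linarith
  set B := (A.filter (fun a => a < 0)).image (fun a => -a) with hB
  have hcard : B.card = (A.filter (fun a => a < 0)).card :=
    Finset.card_image_of_injective _ neg_injective
  have hBA : ∀ b ∈ B, -b ∈ A ∧ 0 < b := by
    intro b hb
    obtain ⟨a, ha, rfl⟩ := Finset.mem_image.1 hb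
    obtain ⟨h1, h2⟩ := Finset.mem_filter.1 ha
    exact ⟨by rwa [neg_neg], by linarith⟩
  rw [← hcard] at hneg
  have := SumProduct.rpow_card_le (A := B)
    (S := (A ×ˢ A ×ˢ A).image (fun p : ℝ × ℝ × ℝ => p.1 * p.2.1 - p.2.2))
    (fun b hb => (hBA b hb).2) (hA'.trans hneg) (by
      intro a ha b hb c hc
      refine Finset.mem_image.2 ⟨(-a, -b, -c), ?_, by ring⟩
      simp only [Finset.mem_product]
      exact ⟨(hBA a ha).1, (hBA b hb).1, (hBA c hc).1⟩)
  refine le_trans ?_ this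
  rw [div_mul_eq_mul_div, ← Real.mul_rpow hδ.le (by positivity)]
  gcongr
end
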